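/- Let q be an odd prime power, let (a,b) be a valid pair in F_q^2 with b ∈ {-a, 2-a, a/(2a-1)}, and let N be the number of intercalates of the quadratic quasigroup Q_{a,b}. Then, as real numbers, q(q-1)(q - 11√q - 38)/32 ≤ N ≤ q(q-1)(q + 11√q + 70)/32. -/

import Mathlib

open scoped Classical
open Finset

noncomputable section

variable {F : Type*} [Field F] [Fintype F]

/-- `x ∈ R_q`: `x` is a nonzero square in `F`. -/
def inR (x : F) : Prop := x ≠ 0 ∧ IsSquare x

/-- `x ∈ N_q`: `x` is a nonzero non-square in `F`. -/
def inN (x : F) : Prop := x ≠ 0 ∧ ¬ IsSquare x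

/-- `(a, b)` is a valid pair: `ab ∈ R_q` and `(a-1)(b-1) ∈ R_q`. -/
def ValidPair (a b : F) : Prop := inR (a * b) ∧ inR ((a - 1) * (b - 1))

/-- The operation of the quadratic quasigroup `Q_{a,b}`:
`x*y = x + a(y-x)` if `y - x ∈ R_q`, `x*y = x + b(y-x)` if `y - x ∈ N_q`, and `x*x = x`. -/
def qmul (a b x y : F) : F :=
  if inR (y - x) then x + a * (y - x) else x + b * (y - x)

section Hasse
open Polynomial

variable {k : Type*} [Field k]

/-- Height of a rational function. -/
def ratH (r : RatFunc k) : ℕ := max r.num.natDegree r.denom.natDegree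

lemma ratH_div_le (A B : k[X]) (hB : B ≠ 0) (n : ℕ) (hA : A.natDegree ≤ n)
    (hBn : B.natDegree ≤ n) :
    ratH (algebraMap k[X] (RatFunc k) A / algebraMap k[X] (RatFunc k) B) ≤ n := by
  unfold ratH
  apply max_le
  · by_cases h : A = 0
    · simp [h]
    · exact (natDegree_le_of_dvd (RatFunc.num_div_dvd A hB) h).trans hA
  · exact (natDegree_le_of_dvd (RatFunc.denom_div_dvd A B) hB).trans hBn

lemma ratH_algebraMap (A : k[X]) : ratH (algebraMap k[X] (RatFunc k) A) = A.natDegree := by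
  simp [ratH, RatFunc.num_algebraMap, RatFunc.denom_algebraMap]

lemma bezout3 {P Q P' Q' : k[X]} (h : IsCoprime P Q) (h' : IsCoprime P' Q') :
    ∃ x y z, x * (P * P') + y * (P * Q' + P' * Q) + z * (Q * Q') = 1 := by
  by_contra hcon
  have hne : Ideal.span {P * P', P * Q' + P' * Q, Q * Q'} ≠ (⊤ : Ideal k[X]) := by
    intro htop
    apply hcon
    have h1 : (1 : k[X]) ∈ Ideal.span {P * P', P * Q' + P' * Q, Q * Q'} := by
      rw [htop]; trivial
    rw [Ideal.mem_span_insert] at h1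
    obtain ⟨x, w, hw, h1⟩ := h1
    rw [Ideal.mem_span_pair] at hw
    obtain ⟨y, z, hw⟩ := hw
    exact ⟨x, y, z, by rw [h1, ← hw]; ring⟩
  obtain ⟨m, hm, hle⟩ := Ideal.exists_le_maximal _ hne
  have hp := hm.isPrime
  have m1 : P * P' ∈ m := hle (Ideal.subset_span (by simp))
  have m2 : P * Q' + P' * Q ∈ m := hle (Ideal.subset_span (by simp))
  have m3 : Q * Q' ∈ m := hle (Ideal.subset_span (by simp))
  have key : ∀ {A B : k[X]}, IsCoprime A B → A ∈ m → B ∈ m → False := by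
    intro A B ⟨u, v, huv⟩ hA hB
    apply hp.ne_top
    rw [Ideal.eq_top_iff_one, ← huv]
    exact m.add_mem (m.mul_mem_left _ hA) (m.mul_mem_left _ hB)
  rcases hp.mem_or_mem m1 with a | a <;> rcases hp.mem_or_mem m3 with c | c
  · exact key h a c
  · have : P' * Q ∈ m := (m.add_mem_iff_right (m.mul_mem_right _ a)).1 m2
    rcases hp.mem_or_mem this with d | d
    · exact key h' d c
    · exact key h a d
  · have : P * Q' ∈ m := (m.add_mem_iff_left (m.mul_mem_right _ a)).1 m2
    rcases hp.mem_or_mem this with d | d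
    · exact key h d c
    · exact key h' a d
  · exact key h' a c

lemma coeff_ne_of_max (P Q : k[X]) (h : Q ≠ 0) :
    P.coeff (max P.natDegree Q.natDegree) ≠ 0 ∨ Q.coeff (max P.natDegree Q.natDegree) ≠ 0 := by
  rcases le_total P.natDegree Q.natDegree with hl | hl
  · right
    rw [max_eq_right hl]
    simpa using h
  · rw [max_eq_left hl]
    by_cases hP : P = 0
    · right
      subst hP
      simp at hl
      simp only [natDegree_zero]
      rw [← hl]
      simpa using h
    · left
      simpa using hP

lemma quad_aux {p q p' q' : k} (h1 : p * p' = 0) (h2 : p * q' + q * p' = 0) (h3 : q * q' = 0)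
    (n1 : p ≠ 0 ∨ q ≠ 0) (n2 : p' ≠ 0 ∨ q' ≠ 0) : False := by
  rcases n1 with n | n <;> simp [n] at h1 h2 h3 <;> simp [h1] at h2 n2 <;> simp_all

lemma height_sum_le (r s : RatFunc k) (C M1 M2 : k[X]) (n : ℕ) (hC : C ≠ 0)
    (dC : C.natDegree ≤ n) (d1 : M1.natDegree ≤ n) (d2 : M2.natDegree ≤ n)
    (h1 : r * s * algebraMap k[X] (RatFunc k) C = algebraMap k[X] (RatFunc k) M1)
    (h2 : (r + s) * algebraMap k[X] (RatFunc k) C = algebraMap k[X] (RatFunc k) M2) :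
    ratH r + ratH s ≤ n := by
  have hr := RatFunc.num_div_denom r
  have hs := RatFunc.num_div_denom s
  have cr := RatFunc.isCoprime_num_denom r
  have cs := RatFunc.isCoprime_num_denom s
  have r0 := RatFunc.denom_ne_zero r
  have s0 := RatFunc.denom_ne_zero s
  unfold ratH
  set P := r.num
  set Q := r.denom
  set P' := s.num
  set Q' := s.denom
  have inj := RatFunc.algebraMap_injective k
  have Q0 : algebraMap k[X] (RatFunc k) Q ≠ 0 := by
    simpa using r0
  have Q0' : algebraMap k[X] (RatFunc k) Q' ≠ 0 := by
    simpa using s0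
  have e1 : P * P' * C = M1 * (Q * Q') := by
    apply inj
    simp only [map_mul]
    rw [← h1, ← hr, ← hs]
    field_simp
  have e2 : (P * Q' + P' * Q) * C = M2 * (Q * Q') := by
    apply inj
    simp only [map_mul, map_add]
    rw [← h2, ← hr, ← hs]
    field_simp
  obtain ⟨x, y, z, hb⟩ := bezout3 cr cs
  have hg : C = (Q * Q') * (x * M1 + y * M2 + z * C) := by
    linear_combination (-C) * hb + x * e1 + y * e2
  set g := x * M1 + y * M2 + z * C
  have g0 : g ≠ 0 := by
    rintro h0
    rw [h0, mul_zero] at hg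
    exact hC hg
  have QQ : Q * Q' ≠ 0 := mul_ne_zero r0 s0
  have f1 : M1 = P * P' * g := by
    apply mul_right_cancel₀ QQ
    rw [← e1]
    conv_lhs => rw [hg]
    ring
  have f2 : M2 = (P * Q' + P' * Q) * g := by
    apply mul_right_cancel₀ QQ
    rw [← e2]
    conv_lhs => rw [hg]
    ring
  have bd : ∀ L M : k[X], M = L * g → M.natDegree ≤ n → L.natDegree ≤ n := by
    intro L M h hM
    by_cases hL : L = 0
    · simp [hL]
    · rw [h, natDegree_mul hL g0] at hM
      omega
  have b1 := bd _ _ f1 d1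
  have b2 := bd _ _ f2 d2
  have b3 := bd _ _ hg dC
  by_contra hlt
  push Not at hlt
  have z1 := coeff_eq_zero_of_natDegree_lt (lt_of_le_of_lt b1 hlt)
  have z2 := coeff_eq_zero_of_natDegree_lt (lt_of_le_of_lt b2 hlt)
  have z3 := coeff_eq_zero_of_natDegree_lt (lt_of_le_of_lt b3 hlt)
  have l1 := le_max_left P.natDegree Q.natDegree
  have l2 := le_max_right P.natDegree Q.natDegree
  have l3 := le_max_left P'.natDegree Q'.natDegree
  have l4 := le_max_right P'.natDegree Q'.natDegree
  rw [coeff_mul_add_eq_of_natDegree_le l1 l3] at z1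
  rw [coeff_mul_add_eq_of_natDegree_le l2 l4] at z3
  rw [coeff_add, coeff_mul_add_eq_of_natDegree_le l1 l4, mul_comm P' Q,
    coeff_mul_add_eq_of_natDegree_le l2 l3] at z2
  have n1 := coeff_ne_of_max P Q r0
  have n2 := coeff_ne_of_max P' Q' s0
  exact quad_aux z1 z2 z3 n1 n2

lemma add_sub_formula {K : Type*} [Field K] (A B x1 y1 x2 y2 : K) (hx : x1 ≠ x2)
    (h1 : y1 ^ 2 = x1 ^ 3 + A * x1 ^ 2 + B * x1) (h2 : y2 ^ 2 = x2 ^ 3 + A * x2 ^ 2 + B * x2) :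
    (((y1 - y2) / (x1 - x2)) ^ 2 - A - x1 - x2) * (((y1 + y2) / (x1 - x2)) ^ 2 - A - x1 - x2)
      * (x1 - x2) ^ 2 = (x1 * x2 - B) ^ 2 ∧
    ((((y1 - y2) / (x1 - x2)) ^ 2 - A - x1 - x2) + (((y1 + y2) / (x1 - x2)) ^ 2 - A - x1 - x2))
      * (x1 - x2) ^ 2 = 2 * (x1 + x2) * (x1 * x2 + B) + 4 * A * x1 * x2 := by
  have hd : x1 - x2 ≠ 0 := sub_ne_zero.2 hx
  constructor
  · have e : (y1 ^ 2 - y2 ^ 2) ^ 2 - 2 * (A + x1 + x2) * (x1 - x2) ^ 2 * (y1 ^ 2 + y2 ^ 2)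
        + (A + x1 + x2) ^ 2 * (x1 - x2) ^ 4 = (x1 - x2) ^ 2 * (x1 * x2 - B) ^ 2 := by
      rw [h1, h2]; ring
    field_simp
    linear_combination e
  · field_simp
    linear_combination 2 * h1 + 2 * h2

end Hasse

section Hasse
open Polynomial

variable {k : Type*} [Field k]

lemma sub_deg {A B : k[X]} {n : ℕ} (h1 : A.natDegree ≤ n) (h2 : B.natDegree ≤ n) :
    (A - B).natDegree ≤ n := (natDegree_sub_le _ _).trans (max_le h1 h2)

/-- The cubic `X^3 + a X^2 + b X`. -/
def cub (a b : k) : k[X] := X ^ 3 + C a * X ^ 2 + C b * X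

lemma cub_natDegree (a b : k) : (cub a b).natDegree = 3 := by
  unfold cub; compute_degree!

lemma cub_ne (a b : k) : cub a b ≠ 0 := by
  intro h
  have := cub_natDegree a b
  rw [h] at this
  simp at this

/-- Coercion of polynomials to rational functions. -/
abbrev am (p : k[X]) : RatFunc k := algebraMap k[X] (RatFunc k) p

lemma am_ne {p : k[X]} (h : p ≠ 0) : am p ≠ 0 := RatFunc.algebraMap_ne_zero h

/-- The quadratic twist of the curve over the function field. -/
def tw (a b : k) : WeierstrassCurve.Affine (RatFunc k) where
  a₁ := 0
  a₂ := am (C a) * am (cub a b)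
  a₃ := 0
  a₄ := am (C b) * am (cub a b) ^ 2
  a₆ := 0

lemma tw_eqn (a b : k) (x y : RatFunc k) : (tw a b).Equation x y ↔
    y ^ 2 = x ^ 3 + (am (C a) * am (cub a b)) * x ^ 2 + (am (C b) * am (cub a b) ^ 2) * x := by
  rw [WeierstrassCurve.Affine.equation_iff]
  simp [tw]

lemma tw_nonsing (a b : k) (h2 : (2 : k) ≠ 0) (hb : b ≠ 0) (hab : a ^ 2 - 4 * b ≠ 0)
    {x y : RatFunc k} (h : (tw a b).Equation x y) : (tw a b).Nonsingular x y := by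
  refine (WeierstrassCurve.Affine.equation_iff_nonsingular_of_Δ_ne_zero ?_).1 h
  have e : (tw a b).Δ = am (C (16 * b ^ 2 * (a ^ 2 - 4 * b)) * cub a b ^ 6) := by
    simp only [WeierstrassCurve.Δ, WeierstrassCurve.b₂, WeierstrassCurve.b₄, WeierstrassCurve.b₆,
      WeierstrassCurve.b₈, tw, am]
    have : (C (16 * b ^ 2 * (a ^ 2 - 4 * b)) : k[X]) = 16 * C b ^ 2 * (C a ^ 2 - 4 * C b) := by
      simp only [map_mul, map_sub, map_pow, map_ofNat]
    rw [this]
    simp only [map_mul, map_sub, map_pow, map_ofNat]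
    ring
  rw [e]
  apply am_ne
  apply mul_ne_zero
  · rw [Ne, C_eq_zero]
    have : (16 : k) = 2 ^ 4 := by norm_num
    rw [this]
    positivity
  · exact pow_ne_zero _ (cub_ne a b)

/-- Height of a point. -/
def hgt (a b : k) (R : (tw a b).Point) : ℕ :=
  match R with
  | .zero => 0
  | .some x _ _ => ratH (x / am (cub a b))

lemma am_cub (a b : k) : am (cub a b) = am X ^ 3 + am (C a) * am X ^ 2 + am (C b) * am X := by
  simp [am, cub]

lemma eqQ (a b : k) : (tw a b).Equation (am (cub a b) * am X) (am (cub a b) ^ 2) := by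
  rw [tw_eqn]
  have := am_cub a b
  set D := am (cub a b)
  linear_combination D ^ 3 * this

lemma hgt_neg (a b : k) (R : (tw a b).Point) : hgt a b (-R) = hgt a b R := by
  rcases R with _ | ⟨x, y, h⟩
  · rfl
  · rw [WeierstrassCurve.Affine.Point.neg_some]; rfl

lemma hgt_add (a b : k) {x1 y1 x2 y2 : RatFunc k} (h1 : (tw a b).Nonsingular x1 y1)
    (h2 : (tw a b).Nonsingular x2 y2) (hx : x1 ≠ x2) :
    hgt a b (.some _ _ h1 + .some _ _ h2) =
      ratH ((((y1 - y2) / (x1 - x2)) ^ 2 - am (C a) * am (cub a b) - x1 - x2) / am (cub a b)) := by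
  rw [WeierstrassCurve.Affine.Point.add_of_X_ne hx]
  simp only [hgt]
  rw [WeierstrassCurve.Affine.slope_of_X_ne hx]
  simp [WeierstrassCurve.Affine.addX, tw]

lemma hgt_sub (a b : k) {x1 y1 x2 y2 : RatFunc k} (h1 : (tw a b).Nonsingular x1 y1)
    (h2 : (tw a b).Nonsingular x2 y2) (hx : x1 ≠ x2) :
    hgt a b (.some _ _ h1 - .some _ _ h2) =
      ratH ((((y1 + y2) / (x1 - x2)) ^ 2 - am (C a) * am (cub a b) - x1 - x2) / am (cub a b)) := by
  rw [sub_eq_add_neg, WeierstrassCurve.Affine.Point.neg_some, hgt_add _ _ _ _ hx]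
  simp [WeierstrassCurve.Affine.negY, tw]

lemma hgt_two (a b : k) (h2 : (2 : k) ≠ 0)
    (hQ : (tw a b).Nonsingular (am (cub a b) * am X) (am (cub a b) ^ 2)) :
    hgt a b (.some _ _ hQ + .some _ _ hQ) ≤ 4 := by
  have hD := am_ne (cub_ne a b)
  have h2' : (2 : RatFunc k) ≠ 0 := by
    have : am (C (2 : k)) ≠ 0 := am_ne (C_ne_zero.2 h2)
    simpa only [am, map_ofNat] using this
  have hy : am (cub a b) ^ 2 ≠ (tw a b).negY (am (cub a b) * am X) (am (cub a b) ^ 2) := by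
    simp only [WeierstrassCurve.Affine.negY, tw]
    intro h
    have : 2 * am (cub a b) ^ 2 = 0 := by linear_combination h
    simp [h2', hD] at this
  rw [WeierstrassCurve.Affine.Point.add_self_of_Y_ne hy]
  simp only [hgt]
  rw [WeierstrassCurve.Affine.slope_of_Y_ne rfl hy]
  have e : (tw a b).addX (am (cub a b) * am X) (am (cub a b) * am X)
      ((3 * (am (cub a b) * am X) ^ 2 + 2 * (tw a b).a₂ * (am (cub a b) * am X) + (tw a b).a₄ -
        (tw a b).a₁ * am (cub a b) ^ 2) / (am (cub a b) ^ 2 -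
        (tw a b).negY (am (cub a b) * am X) (am (cub a b) ^ 2))) / am (cub a b)
      = am ((X ^ 2 - C b) ^ 2) / am (4 * cub a b) := by
    have e4 : am (4 * cub a b) = 4 * am (cub a b) := by simp only [am, map_mul, map_ofNat]
    have e5 : am ((X ^ 2 - C b) ^ 2) = (am X ^ 2 - am (C b)) ^ 2 := by simp [am]
    have h4' : (4 : RatFunc k) ≠ 0 := by
      have : (4 : RatFunc k) = 2 ^ 2 := by norm_num
      rw [this]; exact pow_ne_zero _ h2'
    simp only [WeierstrassCurve.Affine.addX, WeierstrassCurve.Affine.negY, tw]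
    rw [e4, e5]
    have := am_cub a b
    set D := am (cub a b)
    have e6 : D ^ 2 - (-D ^ 2 - 0 * (D * am X) - 0) = 2 * D ^ 2 := by ring
    rw [e6]
    field_simp
    rw [this]
    ring
  rw [e]
  have h4 : (4 : k[X]) ≠ 0 := by
    have : (4 : k[X]) = C (2 ^ 2) := by rw [map_pow, map_ofNat]; norm_num
    rw [this]; exact C_ne_zero.2 (pow_ne_zero _ h2)
  apply ratH_div_le
  · exact mul_ne_zero h4 (cub_ne a b)
  · compute_degree
  · have : (4 : k[X]) = C 4 := (map_ofNat C 4).symm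
    rw [this]
    refine (natDegree_C_mul_le _ _).trans ?_
    rw [cub_natDegree]; norm_num

lemma parallelogram (a b : k) (h2 : (2 : k) ≠ 0)
    (hQ : (tw a b).Nonsingular (am (cub a b) * am X) (am (cub a b) ^ 2)) (R : (tw a b).Point) :
    hgt a b (R + .some _ _ hQ) + hgt a b (R - .some _ _ hQ) ≤ 2 * hgt a b R + 2 := by
  have hD := am_ne (cub_ne a b)
  have hhQ : hgt a b (.some _ _ hQ) = 1 := by
    simp only [hgt]
    rw [mul_div_cancel_left₀ _ hD, ratH_algebraMap]
    simp
  by_cases hR0 : R = 0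
  · subst hR0
    rw [zero_add, zero_sub, hgt_neg, hhQ]
    omega
  by_cases hRQ : R = .some _ _ hQ
  · have := hgt_two a b h2 hQ
    rw [hRQ, sub_self, hhQ]
    have h0 : hgt a b 0 = 0 := rfl
    omega
  by_cases hRQ' : R = -.some _ _ hQ
  · have := hgt_two a b h2 hQ
    have e : -WeierstrassCurve.Affine.Point.some _ _ hQ - .some _ _ hQ
      = -(.some _ _ hQ + .some _ _ hQ) := by abel
    rw [hRQ', neg_add_cancel, e, hgt_neg, hgt_neg, hhQ]
    have h0 : hgt a b 0 = 0 := rfl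
    omega
  rcases R with _ | ⟨x, y, h⟩
  · exact absurd rfl hR0
  have hx : x ≠ am (cub a b) * am X := by
    intro hx
    rcases (WeierstrassCurve.Affine.Point.X_eq_iff (h₁ := h) (h₂ := hQ)).1 hx with h | h
    · exact hRQ h
    · exact hRQ' h
  rw [hgt_add _ _ _ _ hx, hgt_sub _ _ _ _ hx]
  obtain ⟨f1, f2⟩ := add_sub_formula (am (C a) * am (cub a b)) (am (C b) * am (cub a b) ^ 2)
    x y _ _ hx ((tw_eqn _ _ _ _).1 h.1) ((tw_eqn _ _ _ _).1 hQ.1)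
  set U := ((y - am (cub a b) ^ 2) / (x - am (cub a b) * am X)) ^ 2 - am (C a) * am (cub a b) - x
    - am (cub a b) * am X
  set V := ((y + am (cub a b) ^ 2) / (x - am (cub a b) * am X)) ^ 2 - am (C a) * am (cub a b) - x
    - am (cub a b) * am X
  simp only [hgt]
  have hr := RatFunc.num_div_denom (x / am (cub a b))
  have r0 := RatFunc.denom_ne_zero (x / am (cub a b))
  unfold ratH at *
  set P := (x / am (cub a b)).num
  set Q := (x / am (cub a b)).denom
  have l1 := le_max_left P.natDegree Q.natDegree
  have l2 := le_max_right P.natDegree Q.natDegree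
  set m := max P.natDegree Q.natDegree
  have Q0 : am Q ≠ 0 := am_ne r0
  have hx' : x = am (cub a b) * (am P / am Q) := by
    rw [hr]; field_simp
  have degl : ∀ A B : k[X], A.natDegree ≤ m + 1 → B.natDegree ≤ m + 1 →
      (A * B).natDegree ≤ 2 * m + 2 := by
    intro A B hA hB
    refine natDegree_mul_le.trans (by omega)
  have dXP : (X * P).natDegree ≤ m + 1 := natDegree_mul_le.trans (by simp; omega)
  have dXQ : (X * Q).natDegree ≤ m + 1 := natDegree_mul_le.trans (by simp; omega)
  have dCP : ∀ c : k, (C c * P).natDegree ≤ m + 1 := fun c =>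
    (natDegree_C_mul_le _ _).trans (by omega)
  have dCQ : ∀ c : k, (C c * Q).natDegree ≤ m + 1 := fun c =>
    (natDegree_C_mul_le _ _).trans (by omega)
  have key := height_sum_le (U / am (cub a b)) (V / am (cub a b)) ((P - X * Q) * (P - X * Q))
    ((X * P - C b * Q) * (X * P - C b * Q))
    (C 2 * ((P + X * Q) * (X * P + C b * Q)) + C (4 * a) * ((X * P) * Q)) (2 * m + 2) ?_ ?_ ?_ ?_
    ?_ ?_
  · exact key
  · intro h0
    have h0 : P - X * Q = 0 := by simpa using h0
    apply hx
    rw [hx']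
    congr 1
    rw [div_eq_iff Q0, ← map_mul]
    exact congrArg _ (sub_eq_zero.1 h0)
  · have : (P - X * Q).natDegree ≤ m + 1 := sub_deg (by omega) dXQ
    exact degl _ _ this this
  · have : (X * P - C b * Q).natDegree ≤ m + 1 := sub_deg dXP (dCQ b)
    exact degl _ _ this this
  · apply natDegree_add_le_of_degree_le
    · refine (natDegree_C_mul_le _ _).trans (degl _ _ ?_ ?_)
      · exact natDegree_add_le_of_degree_le (by omega) dXQ
      · exact natDegree_add_le_of_degree_le dXP (dCQ b)
    · exact (natDegree_C_mul_le _ _).trans (degl _ _ dXP (by omega))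
  · have eL : algebraMap k[X] (RatFunc k) ((P - X * Q) * (P - X * Q)) = (am P - am X * am Q) ^ 2 := by
      simp only [map_mul, map_sub, am]; ring
    have eR : algebraMap k[X] (RatFunc k) ((X * P - C b * Q) * (X * P - C b * Q)) =
        (am X * am P - am (C b) * am Q) ^ 2 := by
      simp only [map_mul, map_sub, am]; ring
    rw [eL, eR]
    rw [hx'] at f1
    clear_value U V
    set D := am (cub a b)
    field_simp at f1 ⊢
    linear_combination f1
  · have eL : algebraMap k[X] (RatFunc k) ((P - X * Q) * (P - X * Q)) = (am P - am X * am Q) ^ 2 := by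
      simp only [map_mul, map_sub, am]; ring
    have eR : algebraMap k[X] (RatFunc k)
        (C 2 * ((P + X * Q) * (X * P + C b * Q)) + C (4 * a) * ((X * P) * Q)) =
        2 * ((am P + am X * am Q) * (am X * am P + am (C b) * am Q)) +
          4 * am (C a) * (am X * am P * am Q) := by
      have c2 : (C 2 : k[X]) = 2 := map_ofNat C 2
      have c4 : (C (4 * a) : k[X]) = 4 * C a := by rw [map_mul, map_ofNat]
      rw [c2, c4]
      simp only [map_mul, map_add, am, map_ofNat]
    rw [eL, eR]
    rw [hx'] at f2
    clear_value U V
    set D := am (cub a b)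
    field_simp at f2 ⊢
    linear_combination f2

end Hasse

section Hasse
open Polynomial

variable {k : Type*} [Field k]

lemma seq_bound (h : ℕ → ℕ) (q N : ℕ) (hrec : ∀ n, h (n + 2) + h n ≤ 2 * h (n + 1) + 2)
    (h0 : h 0 = q) (h1 : h 1 + 2 * N ≤ 2 * q + 1) (n : ℕ) :
    (n : ℤ) * (2 * N - q) ≤ q + n ^ 2 := by
  have A : ∀ n : ℕ, (h (n + 1) : ℤ) - h n ≤ (q - 2 * N + 1) + 2 * n := by
    intro n
    induction n with
    | zero => simp; omega
    | succ n ih =>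
      have h3 : h (n + 1 + 1) + h n ≤ 2 * h (n + 1) + 2 := hrec n
      push_cast at *
      omega
  have B : ∀ n : ℕ, (h n : ℤ) ≤ q + n * (q - 2 * N) + n ^ 2 := by
    intro n
    induction n with
    | zero => simp [h0]
    | succ n ih =>
      have := A n
      push_cast at *
      linarith
  have := B n
  have := (h n).cast_nonneg (α := ℤ)
  linarith

lemma prod_dvd (S : Finset k) (p : k[X]) (h : ∀ x ∈ S, p.eval x = 0) :
    (∏ x ∈ S, (X - C x)) ∣ p := by
  apply Finset.prod_dvd_of_coprime
  · intro x _ y _ hxy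
    exact (pairwise_coprime_X_sub_C Function.injective_id) hxy
  · intro x hx
    exact dvd_iff_isRoot.2 (h x hx)

variable [Fintype k]

lemma cub_pow_card (a b : k) : cub a b ^ Fintype.card k =
    (X ^ Fintype.card k) ^ 3 + C a * (X ^ Fintype.card k) ^ 2 + C b * X ^ Fintype.card k := by
  rw [← FiniteField.expand_card]
  simp [cub]

lemma count_bound (a b : k) (h2 : (2 : k) ≠ 0) (hb : b ≠ 0) (hab : a ^ 2 - 4 * b ≠ 0)
    (m : ℕ) (hm : Fintype.card k = 2 * m + 1) (s : k) (hs : s ^ 2 = 1) (S : Finset k)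
    (hS : ∀ x ∈ S, ((cub a b).eval x) ^ m = s) (n : ℕ) :
    (n : ℤ) * (2 * S.card - Fintype.card k) ≤ Fintype.card k + n ^ 2 := by
  have hD := am_ne (cub_ne a b)
  have hQ := tw_nonsing a b h2 hb hab (eqQ a b)
  set q := Fintype.card k with hq
  have hq3 : 3 ≤ q := by
    have : 1 < q := Fintype.one_lt_card
    omega
  have eP : (tw a b).Equation (am (cub a b) * am (X ^ q)) (am (cub a b) ^ 2 * am (s • cub a b ^ m)) := by
    rw [tw_eqn]
    have e : am (cub a b ^ q) = am ((X ^ q) ^ 3 + C a * (X ^ q) ^ 2 + C b * X ^ q) := by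
      rw [cub_pow_card]
    simp only [am, map_add, map_mul, map_pow, smul_eq_C_mul] at e ⊢
    have e2 : (algebraMap k[X] (RatFunc k) (C s)) ^ 2 = 1 := by
      rw [← map_pow, ← map_pow, hs, map_one, map_one]
    rw [hm] at e
    rw [hm]
    set D := algebraMap k[X] (RatFunc k) (cub a b)
    have e3 : D ^ (2 * m + 1) = D * (D ^ m) ^ 2 := by ring
    rw [e3] at e
    linear_combination D ^ 4 * (D ^ m) ^ 2 * e2 + D ^ 3 * e
  have hP := tw_nonsing a b h2 hb hab eP
  set P0 : (tw a b).Point := .some _ _ hP with hP0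
  set Q : (tw a b).Point := .some _ _ hQ with hQ0
  have hT : (X ^ q - X : k[X]) ≠ 0 := FiniteField.X_pow_card_sub_X_ne_zero k (by omega)
  have hTd : (X ^ q - X : k[X]).natDegree = q := FiniteField.X_pow_card_sub_X_natDegree_eq k (by omega)
  refine seq_bound (fun n => hgt a b (P0 + n • Q)) q S.card ?_ ?_ ?_ n
  · intro n
    have := parallelogram a b h2 hQ (P0 + (n + 1) • Q)
    have e1 : P0 + (n + 1) • Q + Q = P0 + (n + 2) • Q := by
      rw [show n + 2 = n + 1 + 1 from rfl, succ_nsmul Q (n+1)]; abel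
    have e2 : P0 + (n + 1) • Q - Q = P0 + n • Q := by
      rw [succ_nsmul Q n]; abel
    rw [← hQ0, e1, e2] at this
    exact this
  · have e0 : P0 + 0 • Q = P0 := by rw [zero_nsmul, add_zero]
    simp only [e0]
    simp only [hP0, hgt]
    rw [mul_div_cancel_left₀ _ hD, ratH_algebraMap]
    simp
  · have hx : am (cub a b) * am (X ^ q) ≠ am (cub a b) * am X := by
      intro h
      have := mul_left_cancel₀ hD h
      exact hT (sub_eq_zero.2 (RatFunc.algebraMap_injective k this))
    simp only [one_smul, hP0, hQ0]
    rw [hgt_add _ _ _ _ hx]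
    set G := ∏ x ∈ S, (X - C x) with hG
    have Gd : G.natDegree = S.card := by simp [hG]
    have G0 : G ≠ 0 := (monic_prod_of_monic _ _ fun x _ => monic_X_sub_C x).ne_zero
    obtain ⟨B, hB⟩ : G ∣ X ^ q - X := prod_dvd S _ (by
      intro x _
      simp [hq, FiniteField.pow_card])
    obtain ⟨A, hA⟩ : G ∣ s • cub a b ^ m - 1 := prod_dvd S _ (by
      intro x hx
      simp [hS x hx, ← pow_two, hs])
    have hB0 : B ≠ 0 := by
      rintro rfl
      simp at hB
      exact hT hB
    have key : (((am (cub a b) ^ 2 * am (s • cub a b ^ m) - am (cub a b) ^ 2) /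
        (am (cub a b) * am (X ^ q) - am (cub a b) * am X)) ^ 2 - am (C a) * am (cub a b) -
          am (cub a b) * am (X ^ q) - am (cub a b) * am X) / am (cub a b) =
        am (cub a b * A ^ 2 - (C a + X ^ q + X) * B ^ 2) / am (B ^ 2) := by
      have hA' : am (s • cub a b ^ m) = am G * am A + 1 := by
        rw [← map_mul, ← hA]; simp [am]
      have hB' : am (X ^ q) = am G * am B + am X := by
        rw [← map_mul, ← hB]; simp [am]
      have G0' := am_ne G0
      have B0' := am_ne hB0
      have e : am (cub a b * A ^ 2 - (C a + X ^ q + X) * B ^ 2) =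
        am (cub a b) * am A ^ 2 - (am (C a) + am (X ^ q) + am X) * am B ^ 2 := by
        simp [am]
      have e' : am (B ^ 2) = am B ^ 2 := by simp [am]
      rw [e, e', hA', hB']
      set D := am (cub a b)
      have e3 : (D ^ 2 * (am G * am A + 1) - D ^ 2) / (D * (am G * am B + am X) - D * am X)
          = D * am A / am B := by
        have : D * (am G * am B + am X) - D * am X = D * (am G * am B) := by ring
        rw [this]
        field_simp
        ring
      rw [e3]
      field_simp
      ring
    rw [key]
    have hdB : B.natDegree + S.card = q := by
      rw [← hTd, hB, natDegree_mul G0 hB0, Gd, add_comm]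
    have hbound : ratH (am (cub a b * A ^ 2 - (C a + X ^ q + X) * B ^ 2) / am (B ^ 2)) ≤
        2 * q + 1 - 2 * S.card := by
      apply ratH_div_le _ _ (pow_ne_zero _ hB0)
      · set W := cub a b * A ^ 2 - (C a + X ^ q + X) * B ^ 2 with hW
        have e1 : G ^ 2 * W = C b * X ^ q - C (2 * s) * cub a b ^ (m + 1) + C b * X
            + (X ^ q) ^ 2 * X + C (2 * a) * (X ^ q * X) + X ^ q * X ^ 2 := by
          have hp := cub_pow_card a b
          rw [← hq] at hp
          have e3 : cub a b ^ q = cub a b * (cub a b ^ m) ^ 2 := by rw [hm]; ring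
          have e4 : G ^ 2 * W = cub a b * (G * A) ^ 2 - (C a + X ^ q + X) * (G * B) ^ 2 := by
            rw [hW]; ring
          rw [e4, ← hA, ← hB, smul_eq_C_mul]
          have e2 : (C s : k[X]) ^ 2 = 1 := by
            rw [← map_pow, hs, map_one]
          have c2 : (C (2 * s) : k[X]) = 2 * C s := by rw [map_mul, map_ofNat]
          have c3 : (C (2 * a) : k[X]) = 2 * C a := by rw [map_mul, map_ofNat]
          have hc : cub a b = X ^ 3 + C a * X ^ 2 + C b * X := rfl
          rw [c2, c3]
          rw [e3] at hp
          linear_combination (cub a b * (cub a b ^ m) ^ 2) * e2 + hp + hc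
        have d1 : (G ^ 2 * W).natDegree ≤ 2 * q + 1 := by
          rw [e1]
          have hqm : (X ^ q : k[X]).natDegree = q := by simp
          have hcm : (cub a b ^ (m + 1)).natDegree = 3 * (m + 1) := by
            rw [natDegree_pow, cub_natDegree]; ring
          refine natDegree_add_le_of_degree_le (natDegree_add_le_of_degree_le
            (natDegree_add_le_of_degree_le (natDegree_add_le_of_degree_le
              (sub_deg ?_ ?_) ?_) ?_) ?_) ?_
          · refine (natDegree_C_mul_le _ _).trans (by omega)
          · refine (natDegree_C_mul_le _ _).trans (by omega)
          · refine (natDegree_C_mul_le _ _).trans (by simp)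
          · refine natDegree_mul_le.trans ?_
            rw [natDegree_pow, hqm, natDegree_X]
          · refine (natDegree_C_mul_le _ _).trans (natDegree_mul_le.trans ?_)
            simp
            omega
          · refine natDegree_mul_le.trans ?_
            simp
            omega
        by_cases hW0 : W = 0
        · simp [hW0]
        · rw [natDegree_mul (pow_ne_zero _ G0) hW0, natDegree_pow, Gd] at d1
          omega
      · rw [natDegree_pow]; omega
    omega

lemma weak_hasse (a b : k) (h2 : (2 : k) ≠ 0) (hb : b ≠ 0) (hab : a ^ 2 - 4 * b ≠ 0) :
    |((∑ x : k, quadraticChar k (x ^ 3 + a * x ^ 2 + b * x) : ℤ) : ℝ)| ≤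
      2 * Real.sqrt (Fintype.card k) + 4 := by
  have hch : ringChar k ≠ 2 := by
    intro h
    have := ringChar.spec k 2
    rw [h] at this
    exact h2 (by exact_mod_cast this.2 dvd_rfl)
  have hodd := FiniteField.odd_card_of_char_ne_two hch
  set q := Fintype.card k with hq
  obtain ⟨m, hm⟩ : ∃ m, q = 2 * m + 1 := ⟨q / 2, by omega⟩
  have hev : ∀ x : k, (cub a b).eval x = x ^ 3 + a * x ^ 2 + b * x := by
    intro x; simp [cub]
  have hpow : ∀ x : k, ((quadraticChar k x : ℤ) : k) = x ^ m := by
    intro x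
    rw [quadraticChar_eq_pow_of_char_ne_two' hch]
    congr 1
    omega
  set φ : k → ℤ := fun x => quadraticChar k (x ^ 3 + a * x ^ 2 + b * x) with hφ
  have A := count_bound a b h2 hb hab m hm 1 (by simp) (univ.filter fun x => φ x = 1) (by
    intro x hx
    rw [hev, ← hpow]
    have : φ x = 1 := by simpa using hx
    rw [show quadraticChar k (x ^ 3 + a * x ^ 2 + b * x) = _ from this]; simp)
  have B := count_bound a b h2 hb hab m hm (-1) (by simp) (univ.filter fun x => φ x = -1) (by
    intro x hx
    rw [hev, ← hpow]
    have : φ x = -1 := by simpa using hx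
    rw [show quadraticChar k (x ^ 3 + a * x ^ 2 + b * x) = _ from this]; simp)
  set np := (univ.filter fun x => φ x = 1).card
  set nm := (univ.filter fun x => φ x = -1).card
  have Z : (univ.filter fun x => φ x = 0).card ≤ 3 := by
    rw [← cub_natDegree a b]
    refine le_trans (Finset.card_le_card ?_) ((cub a b).roots.toFinset_card_le.trans (card_roots' _))
    intro x hx
    simp only [hφ, mem_filter, mem_univ, true_and, quadraticChar_eq_zero_iff] at hx
    simp [cub_ne, hev, hx]
  set nz := (univ.filter fun x => φ x = 0).card
  have tri : ∀ x, φ x = 0 ∨ φ x = 1 ∨ φ x = -1 := fun x => by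
    by_cases h : x ^ 3 + a * x ^ 2 + b * x = 0
    · left; simp [hφ, h]
    · right; exact quadraticChar_dichotomy h
  have hsum : ∑ x, φ x = (np : ℤ) - nm := by
    simp only [np, nm, Finset.card_filter]
    push_cast
    rw [← Finset.sum_sub_distrib]
    apply Finset.sum_congr rfl
    intro x _
    rcases tri x with h | h | h <;> simp [h]
  have htot : (np : ℤ) + nm + nz = q := by
    have : (q : ℤ) = ∑ x : k, 1 := by simp [hq]
    rw [this]
    simp only [np, nm, nz, Finset.card_filter]
    push_cast
    rw [← Finset.sum_add_distrib, ← Finset.sum_add_distrib]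
    apply Finset.sum_congr rfl
    intro x _
    rcases tri x with h | h | h <;> simp [h]
  rw [hsum]
  set r := Real.sqrt q
  have hr : r ^ 2 = q := Real.sq_sqrt (by positivity)
  have hq0 : (0 : ℝ) < q := by
    have : 0 < q := Fintype.card_pos
    exact_mod_cast this
  have hr0 : 0 < r := Real.sqrt_pos.2 hq0
  set n := ⌈r⌉₊
  have hn1 : r ≤ n := Nat.le_ceil r
  have hn2 : (n : ℝ) < r + 1 := Nat.ceil_lt_add_one hr0.le
  have hn0 : (0 : ℝ) < n := hr0.trans_le hn1
  have A' : (n : ℝ) * (2 * np - q) ≤ q + n ^ 2 := by exact_mod_cast A n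
  have B' : (n : ℝ) * (2 * nm - q) ≤ q + n ^ 2 := by exact_mod_cast B n
  have htot' : (np : ℝ) + nm + nz = q := by exact_mod_cast htot
  have Z' : (nz : ℝ) ≤ 3 := by exact_mod_cast Z
  have fin : ∀ t : ℝ, n * t ≤ q + n ^ 2 → t ≤ 2 * r + 1 := by
    intro t ht
    by_contra hc
    push Not at hc
    have : (n : ℝ) * (n + r) < n * t := by
      apply mul_lt_mul_of_pos_left _ hn0
      linarith
    nlinarith
  have A2 := fin _ A'
  have B2 := fin _ B'
  push_cast
  rw [abs_le]
  constructor <;> linarith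

end Hasse

section Count

/-- Abbreviation for the quadratic character. -/
abbrev ch (x : F) : ℤ := quadraticChar F x

lemma char_ne (h2 : (2 : F) ≠ 0) : ringChar F ≠ 2 := by
  intro h
  have := ringChar.spec F 2
  rw [h] at this
  exact h2 (by exact_mod_cast this.2 dvd_rfl)

lemma odd_sum (h2 : (2 : F) ≠ 0) (g : F × F → ℤ)
    (hg : ∀ c : F, c ≠ 0 → ch c = -1 → ∀ p : F × F, g (c * p.1, c * p.2) = - g p) :
    ∑ p : F × F, g p = 0 := by
  obtain ⟨c, hc⟩ := quadraticChar_exists_neg_one (char_ne h2)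
  have c0 : c ≠ 0 := by rintro rfl; simp at hc
  have hbij : Function.Bijective (fun p : F × F => (c * p.1, c * p.2)) := by
    apply Finite.injective_iff_bijective.1
    rintro ⟨x, y⟩ ⟨x', y'⟩ h
    simp [c0] at h
    simp [h]
  have := hbij.sum_comp g
  have e : ∑ p : F × F, g (c * p.1, c * p.2) = - ∑ p : F × F, g p := by
    rw [← Finset.sum_neg_distrib]
    exact Finset.sum_congr rfl fun p _ => hg c c0 hc p
  rw [e] at this
  omega

lemma pair_sum (h2 : (2 : F) ≠ 0) (p q r s : F) (hd : p * s - q * r ≠ 0) :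
    ∑ w : F × F, ch (p * w.1 + q * w.2) * ch (r * w.1 + s * w.2) = 0 := by
  have hbij : Function.Bijective
      (fun w : F × F => (p * w.1 + q * w.2, r * w.1 + s * w.2)) := by
    apply Finite.injective_iff_bijective.1
    rintro ⟨x, y⟩ ⟨x', y'⟩ h
    simp only [Prod.mk.injEq] at h
    obtain ⟨ha, hb⟩ := h
    have e1 : (p * s - q * r) * (x - x') = 0 := by linear_combination s * ha - q * hb
    have e2 : (p * s - q * r) * (y - y') = 0 := by linear_combination p * hb - r * ha
    simp only [mul_eq_zero, hd, false_or, sub_eq_zero] at e1 e2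
    simp [e1, e2]
  rw [hbij.sum_comp (fun w : F × F => ch w.1 * ch w.2), Fintype.sum_prod_type]
  simp only [← Finset.mul_sum]
  rw [quadraticChar_sum_zero (char_ne h2)]
  simp

lemma quad_sum (h2 : (2 : F) ≠ 0) (c1 c2 d1 d2 : F) (hc1 : c1 ≠ 0) (hc2 : c2 ≠ 0) (hd1 : d1 ≠ 0)
    (hd2 : d2 ≠ 0) (hd : c1 * d2 - c2 * d1 ≠ 0) :
    |((∑ w : F × F, ch w.1 * ch w.2 * ch (c1 * w.1 + c2 * w.2) * ch (d1 * w.1 + d2 * w.2) : ℤ) : ℝ)|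
      ≤ ((Fintype.card F : ℝ) - 1) * (2 * Real.sqrt (Fintype.card F) + 4) := by
  have key := weak_hasse (c2 / c1 + d2 / d1) (c2 * d2 / (c1 * d1)) h2 (by positivity) (by
    have : (c2 / c1 + d2 / d1) ^ 2 - 4 * (c2 * d2 / (c1 * d1)) =
      ((c1 * d2 - c2 * d1) / (c1 * d1)) ^ 2 := by field_simp; ring
    rw [this]
    positivity)
  set S : ℤ := ∑ x : F, quadraticChar F (x ^ 3 + (c2 / c1 + d2 / d1) * x ^ 2 +
    (c2 * d2 / (c1 * d1)) * x)
  have inner : ∀ v : F, ∑ u : F, ch u * ch v * ch (c1 * u + c2 * v) * ch (d1 * u + d2 * v) =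
      if v = 0 then 0 else ch (c1 * d1) * S := by
    intro v
    split_ifs with hv
    · simp [hv]
    · have hbij : Function.Bijective (fun x : F => v * x) := by
        apply Finite.injective_iff_bijective.1
        intro x y h
        exact mul_left_cancel₀ hv h
      rw [← hbij.sum_comp, Finset.mul_sum]
      apply Finset.sum_congr rfl
      intro x _
      simp only [ch]
      rw [← map_mul, ← map_mul, ← map_mul, ← map_mul]
      have e : v * x * v * (c1 * (v * x) + c2 * v) * (d1 * (v * x) + d2 * v) =
        (v ^ 2) ^ 2 * (c1 * d1 * (x ^ 3 + (c2 / c1 + d2 / d1) * x ^ 2 +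
          (c2 * d2 / (c1 * d1)) * x)) := by field_simp; ring
      rw [e, map_mul, quadraticChar_sq_one' (pow_ne_zero _ hv), one_mul]
  have tot : ∑ w : F × F, ch w.1 * ch w.2 * ch (c1 * w.1 + c2 * w.2) * ch (d1 * w.1 + d2 * w.2)
      = ((Fintype.card F : ℤ) - 1) * (ch (c1 * d1) * S) := by
    rw [Fintype.sum_prod_type, Finset.sum_comm]
    simp only [inner]
    rw [Finset.sum_ite]
    simp only [sum_const_zero, zero_add, sum_const, nsmul_eq_mul]
    congr 1
    rw [Finset.filter_ne' univ (0 : F), Finset.card_erase_of_mem (mem_univ _), Finset.card_univ,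
      Nat.cast_sub Fintype.card_pos]
    simp
  rw [tot]
  push_cast
  have hq : (1 : ℝ) ≤ Fintype.card F := by exact_mod_cast (Fintype.card_pos (α := F))
  rw [abs_mul, abs_mul, abs_of_nonneg (by linarith)]
  have : |((ch (c1 * d1) : ℤ) : ℝ)| = 1 := by
    rcases quadraticChar_dichotomy (F := F) (a := c1 * d1) (by positivity) with h | h <;> simp [ch, h]
  rw [this, one_mul]
  exact mul_le_mul_of_nonneg_left key (by linarith)

/-- The product counting a sign pattern. -/
def prd (c1 c2 d1 d2 : F) (e1 e2 e3 e4 : ℤ) (w : F × F) : ℤ :=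
  (1 + e1 * ch w.1) * (1 + e2 * ch w.2) * (1 + e3 * ch (c1 * w.1 + c2 * w.2)) *
    (1 + e4 * ch (d1 * w.1 + d2 * w.2))

lemma plane_sum (h2 : (2 : F) ≠ 0) (c1 c2 d1 d2 : F) (hc1 : c1 ≠ 0) (hc2 : c2 ≠ 0) (hd1 : d1 ≠ 0)
    (hd2 : d2 ≠ 0) (hd : c1 * d2 - c2 * d1 ≠ 0) (e1 e2 e3 e4 : ℤ) (he1 : e1 = 1 ∨ e1 = -1)
    (he2 : e2 = 1 ∨ e2 = -1) (he3 : e3 = 1 ∨ e3 = -1) (he4 : e4 = 1 ∨ e4 = -1) :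
    |((∑ w : F × F, prd c1 c2 d1 d2 e1 e2 e3 e4 w : ℤ) : ℝ) - (Fintype.card F : ℝ) ^ 2|
      ≤ ((Fintype.card F : ℝ) - 1) * (2 * Real.sqrt (Fintype.card F) + 4) := by
  have Q := quad_sum h2 c1 c2 d1 d2 hc1 hc2 hd1 hd2 hd
  set A : F × F → ℤ := fun w => ch w.1 with hA
  set B : F × F → ℤ := fun w => ch w.2 with hB
  set C : F × F → ℤ := fun w => ch (c1 * w.1 + c2 * w.2) with hC
  set D : F × F → ℤ := fun w => ch (d1 * w.1 + d2 * w.2) with hD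
  have p1 : ∑ w, A w * B w = 0 := by
    simpa [A, B] using pair_sum h2 1 0 0 1 (by simp)
  have p2 : ∑ w, A w * C w = 0 := by
    simpa [A, C] using pair_sum h2 1 0 c1 c2 (by simpa)
  have p3 : ∑ w, A w * D w = 0 := by
    simpa [A, D] using pair_sum h2 1 0 d1 d2 (by simpa)
  have p4 : ∑ w, B w * C w = 0 := by
    simpa [B, C] using pair_sum h2 0 1 c1 c2 (by simpa)
  have p5 : ∑ w, B w * D w = 0 := by
    simpa [B, D] using pair_sum h2 0 1 d1 d2 (by simpa)
  have p6 : ∑ w, C w * D w = 0 := by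
    simpa [C, D] using pair_sum h2 c1 c2 d1 d2 hd
  have po : ∑ w, (e1 * A w + e2 * B w + e3 * C w + e4 * D w + e1 * e2 * e3 * (A w * B w * C w)
      + e1 * e2 * e4 * (A w * B w * D w) + e1 * e3 * e4 * (A w * C w * D w)
      + e2 * e3 * e4 * (B w * C w * D w)) = 0 := by
    apply odd_sum h2
    intro c c0 hc w
    have a1 : A (c * w.1, c * w.2) = - A w := by
      simp only [A, ch, map_mul]; rw [show quadraticChar F c = -1 from hc]; ring
    have a2 : B (c * w.1, c * w.2) = - B w := by
      simp only [B, ch, map_mul]; rw [show quadraticChar F c = -1 from hc]; ring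
    have a3 : C (c * w.1, c * w.2) = - C w := by
      simp only [C, ch]
      rw [show c1 * (c * w.1) + c2 * (c * w.2) = c * (c1 * w.1 + c2 * w.2) by ring, map_mul,
        show quadraticChar F c = -1 from hc]; ring
    have a4 : D (c * w.1, c * w.2) = - D w := by
      simp only [D, ch]
      rw [show d1 * (c * w.1) + d2 * (c * w.2) = c * (d1 * w.1 + d2 * w.2) by ring, map_mul,
        show quadraticChar F c = -1 from hc]; ring
    rw [a1, a2, a3, a4]
    ring
  have tot : ∑ w : F × F, prd c1 c2 d1 d2 e1 e2 e3 e4 w = (Fintype.card F : ℤ) ^ 2 +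
      e1 * e2 * e3 * e4 * ∑ w, A w * B w * C w * D w := by
    have ex : ∀ w, prd c1 c2 d1 d2 e1 e2 e3 e4 w = 1 + (e1 * A w + e2 * B w + e3 * C w + e4 * D w + e1 * e2 * e3 * (A w * B w * C w)
      + e1 * e2 * e4 * (A w * B w * D w) + e1 * e3 * e4 * (A w * C w * D w)
      + e2 * e3 * e4 * (B w * C w * D w)) + e1 * e2 * (A w * B w) + e1 * e3 * (A w * C w)
      + e1 * e4 * (A w * D w) + e2 * e3 * (B w * C w) + e2 * e4 * (B w * D w)
      + e3 * e4 * (C w * D w) + e1 * e2 * e3 * e4 * (A w * B w * C w * D w) := by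
      intro w
      simp only [prd, A, B, C, D]
      ring
    simp only [ex]
    simp only [Finset.sum_add_distrib, ← Finset.mul_sum] at po ⊢
    rw [p1, p2, p3, p4, p5, p6, po]
    simp
    ring
  rw [tot]
  have hs : |((e1 * e2 * e3 * e4 : ℤ) : ℝ)| = 1 := by
    rcases he1 with rfl | rfl <;> rcases he2 with rfl | rfl <;> rcases he3 with rfl | rfl <;>
      rcases he4 with rfl | rfl <;> simp
  rw [Int.cast_add, Int.cast_pow, Int.cast_natCast, add_sub_cancel_left, Int.cast_mul, abs_mul, hs,
    one_mul]
  exact Q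

/-- Number of vanishing forms. -/
def zr (c1 c2 d1 d2 : F) (w : F × F) : ℤ :=
  (if w.1 = 0 then 1 else 0) + (if w.2 = 0 then 1 else 0) +
  (if c1 * w.1 + c2 * w.2 = 0 then 1 else 0) + (if d1 * w.1 + d2 * w.2 = 0 then 1 else 0)

lemma line_sum (c1 c2 : F) (hc2 : c2 ≠ 0) :
    ∑ w : F × F, (if c1 * w.1 + c2 * w.2 = 0 then (1 : ℤ) else 0) = Fintype.card F := by
  rw [Fintype.sum_prod_type]
  have : ∀ u : F, ∑ v : F, (if c1 * u + c2 * v = 0 then (1 : ℤ) else 0) = 1 := by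
    intro u
    rw [Finset.sum_eq_single (- (c1 * u) / c2)]
    · rw [if_pos]; field_simp; ring
    · intro v _ hv
      rw [if_neg]
      intro h
      apply hv
      field_simp
      linear_combination h
    · simp
  simp [this]

lemma zr_sum (c1 c2 d1 d2 : F) (hc2 : c2 ≠ 0) (hd2 : d2 ≠ 0) :
    ∑ w : F × F, zr c1 c2 d1 d2 w = 4 * Fintype.card F := by
  simp only [zr, Finset.sum_add_distrib]
  rw [line_sum c1 c2 hc2, line_sum d1 d2 hd2]
  have h1 : ∑ w : F × F, (if w.2 = 0 then (1 : ℤ) else 0) = Fintype.card F := by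
    simpa using line_sum (0 : F) 1 one_ne_zero
  have h2 : ∑ w : F × F, (if w.1 = 0 then (1 : ℤ) else 0) = Fintype.card F := by
    rw [Fintype.sum_prod_type, Finset.sum_comm]
    simp
  rw [h1, h2]
  ring

end Count

section Pattern

/-- Sign attached to a boolean. -/
def eps (s : Bool) : ℤ := if s then 1 else -1

lemma eps_or (s : Bool) : eps s = 1 ∨ eps s = -1 := by
  cases s <;> simp [eps]

lemma fac (s : Bool) (x : F) :
    (x = 0 ∧ 1 + eps s * ch x = 1) ∨ (x ≠ 0 ∧ (inR x ↔ s = true) ∧ 1 + eps s * ch x = 2) ∨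
    (x ≠ 0 ∧ ¬ (inR x ↔ s = true) ∧ 1 + eps s * ch x = 0) := by
  by_cases hx : x = 0
  · left; simp [hx, ch]
  · right
    by_cases h : IsSquare x
    · have : ch x = 1 := (quadraticChar_one_iff_isSquare hx).2 h
      cases s <;> simp [inR, hx, h, this, eps]
    · have : ch x = -1 := quadraticChar_neg_one_iff_not_isSquare.2 h
      cases s <;> simp [inR, hx, h, this, eps]

/-- Integer indicator of a proposition. -/
def ind (P : Prop) : ℤ := if P then 1 else 0

lemma ind_pos {P : Prop} (h : P) : ind P = 1 := if_pos h

lemma ind_neg {P : Prop} (h : ¬ P) : ind P = 0 := if_neg h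

lemma ind_nonneg (P : Prop) : 0 ≤ ind P := by unfold ind; split_ifs <;> simp

lemma card_ind {α : Type*} [Fintype α] (p : α → Prop) [DecidablePred p] :
    ((univ.filter p).card : ℤ) = ∑ w, ind (p w) := by
  rw [Finset.card_filter]
  push_cast
  exact Finset.sum_congr rfl fun w _ => by by_cases h : p w <;> simp [ind, h]

lemma up_aux {P1 P2 P3 P4 z1 z2 z3 z4 : Prop} {f1 f2 f3 f4 : ℤ}
    (h1 : (z1 ∧ f1 = 1) ∨ (¬ z1 ∧ P1 ∧ f1 = 2) ∨ (¬ z1 ∧ ¬ P1 ∧ f1 = 0))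
    (h2 : (z2 ∧ f2 = 1) ∨ (¬ z2 ∧ P2 ∧ f2 = 2) ∨ (¬ z2 ∧ ¬ P2 ∧ f2 = 0))
    (h3 : (z3 ∧ f3 = 1) ∨ (¬ z3 ∧ P3 ∧ f3 = 2) ∨ (¬ z3 ∧ ¬ P3 ∧ f3 = 0))
    (h4 : (z4 ∧ f4 = 1) ∨ (¬ z4 ∧ P4 ∧ f4 = 2) ∨ (¬ z4 ∧ ¬ P4 ∧ f4 = 0))
    (d12 : ¬ (z1 ∧ z2)) (d13 : ¬ (z1 ∧ z3)) (d14 : ¬ (z1 ∧ z4)) (d23 : ¬ (z2 ∧ z3))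
    (d24 : ¬ (z2 ∧ z4)) (d34 : ¬ (z3 ∧ z4)) :
    16 * ind (P1 ∧ P2 ∧ P3 ∧ P4) ≤ f1 * f2 * f3 * f4 +
      8 * (ind z1 + ind z2 + ind z3
        + ind z4) := by
  have n1 : 0 ≤ f1 := by rcases h1 with ⟨_, h⟩ | ⟨_, _, h⟩ | ⟨_, _, h⟩ <;> simp [h]
  have n2 : 0 ≤ f2 := by rcases h2 with ⟨_, h⟩ | ⟨_, _, h⟩ | ⟨_, _, h⟩ <;> simp [h]
  have n3 : 0 ≤ f3 := by rcases h3 with ⟨_, h⟩ | ⟨_, _, h⟩ | ⟨_, _, h⟩ <;> simp [h]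
  have n4 : 0 ≤ f4 := by rcases h4 with ⟨_, h⟩ | ⟨_, _, h⟩ | ⟨_, _, h⟩ <;> simp [h]
  by_cases hP : P1 ∧ P2 ∧ P3 ∧ P4
  · obtain ⟨q1, q2, q3, q4⟩ := hP
    simp only [q1, q2, q3, q4, not_true_eq_false, false_and, and_false, or_false, true_and] at *
    rcases h1 with ⟨a1, rfl⟩ | ⟨a1, rfl⟩ <;>
    rcases h2 with ⟨a2, rfl⟩ | ⟨a2, rfl⟩ <;>
    rcases h3 with ⟨a3, rfl⟩ | ⟨a3, rfl⟩ <;>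
    rcases h4 with ⟨a4, rfl⟩ | ⟨a4, rfl⟩ <;>
    first
    | exact (d12 (And.intro a1 a2)).elim
    | exact (d13 (And.intro a1 a3)).elim
    | exact (d14 (And.intro a1 a4)).elim
    | exact (d23 (And.intro a2 a3)).elim
    | exact (d24 (And.intro a2 a4)).elim
    | exact (d34 (And.intro a3 a4)).elim
    | (simp [ind, a1, a2, a3, a4])
  · rw [ind_neg hP]
    have := ind_nonneg z1
    have := ind_nonneg z2
    have := ind_nonneg z3
    have := ind_nonneg z4
    positivity

lemma ite_mono {A B : Prop} (h : A → B) : 16 * ind (A) ≤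
    16 * ind (B) := by
  by_cases hA : A
  · simp [ind, hA, h hA]
  · by_cases hB : B <;> simp [ind, hA, hB]

lemma ite_mono3 {A B Z W : Prop} (h : ¬ Z → ¬ W → B) : 16 * ind (A) ≤
    16 * ind (B ∧ A) + 16 * ind (Z) +
      16 * ind (W) := by
  by_cases hA : A <;> by_cases hZ : Z <;> by_cases hW : W <;> by_cases hB : B <;>
    simp [ind, hA, hZ, hW, hB]
  exact hB (h hZ hW)

lemma low_aux {P1 P2 P3 P4 z1 z2 z3 z4 : Prop} {f1 f2 f3 f4 : ℤ}
    (h1 : (z1 ∧ f1 = 1) ∨ (¬ z1 ∧ P1 ∧ f1 = 2) ∨ (¬ z1 ∧ ¬ P1 ∧ f1 = 0))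
    (h2 : (z2 ∧ f2 = 1) ∨ (¬ z2 ∧ P2 ∧ f2 = 2) ∨ (¬ z2 ∧ ¬ P2 ∧ f2 = 0))
    (h3 : (z3 ∧ f3 = 1) ∨ (¬ z3 ∧ P3 ∧ f3 = 2) ∨ (¬ z3 ∧ ¬ P3 ∧ f3 = 0))
    (h4 : (z4 ∧ f4 = 1) ∨ (¬ z4 ∧ P4 ∧ f4 = 2) ∨ (¬ z4 ∧ ¬ P4 ∧ f4 = 0)) :
    f1 * f2 * f3 * f4 ≤ 16 * ind (P1 ∧ P2 ∧ P3 ∧ P4) +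
      8 * (ind z1 + ind z2 + ind z3
        + ind z4) := by
  have e := ind_nonneg (P1 ∧ P2 ∧ P3 ∧ P4)
  rcases h1 with ⟨a1, rfl⟩ | ⟨a1, b1, rfl⟩ | ⟨a1, b1, rfl⟩ <;>
  rcases h2 with ⟨a2, rfl⟩ | ⟨a2, b2, rfl⟩ | ⟨a2, b2, rfl⟩ <;>
  rcases h3 with ⟨a3, rfl⟩ | ⟨a3, b3, rfl⟩ | ⟨a3, b3, rfl⟩ <;>
  rcases h4 with ⟨a4, rfl⟩ | ⟨a4, b4, rfl⟩ | ⟨a4, b4, rfl⟩ <;>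
  first
  | (simp [ind, *]; done)
  | (simp only [ind, a1, a2, a3, a4, if_true, if_false] at e ⊢; linarith)

/-- The pattern predicate on the plane. -/
def pat (c1 c2 d1 d2 : F) (s1 s2 s3 s4 : Bool) (w : F × F) : Prop :=
  (inR w.1 ↔ s1 = true) ∧ (inR w.2 ↔ s2 = true) ∧ (inR (c1 * w.1 + c2 * w.2) ↔ s3 = true) ∧
    (inR (d1 * w.1 + d2 * w.2) ↔ s4 = true)

lemma T_upper (h2 : (2 : F) ≠ 0) (c1 c2 d1 d2 : F) (hc1 : c1 ≠ 0) (hc2 : c2 ≠ 0) (hd1 : d1 ≠ 0)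
    (hd2 : d2 ≠ 0) (hd : c1 * d2 - c2 * d1 ≠ 0) (s1 s2 s3 s4 : Bool) (E : F × F → Prop)
    (hE : ¬ E (0, 0)) :
    16 * ((univ.filter fun w => E w ∧ pat c1 c2 d1 d2 s1 s2 s3 s4 w).card : ℝ) ≤
      ((Fintype.card F : ℝ) - 1) * (Fintype.card F + 33 + (2 * Real.sqrt (Fintype.card F) + 4)) := by
  have P := (abs_le.1 (plane_sum h2 c1 c2 d1 d2 hc1 hc2 hd1 hd2 hd (eps s1) (eps s2) (eps s3) (eps s4)
    (eps_or _) (eps_or _) (eps_or _) (eps_or _))).2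
  have Z := zr_sum c1 c2 d1 d2 hc2 hd2
  have key : 16 * ((univ.filter fun w => E w ∧ pat c1 c2 d1 d2 s1 s2 s3 s4 w).card : ℤ) ≤
      ∑ w : F × F, (prd c1 c2 d1 d2 (eps s1) (eps s2) (eps s3) (eps s4) w + 8 * zr c1 c2 d1 d2 w
        - (if w = (0, 0) then 33 else 0)) := by
    rw [card_ind]
    rw [Finset.mul_sum]
    apply Finset.sum_le_sum
    rintro ⟨u, v⟩ _
    by_cases hw : (u, v) = (0, 0)
    · rw [hw]
      simp [hE, prd, zr, ch, ind]
    · rw [if_neg hw, sub_zero]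
      have := up_aux (fac s1 u) (fac s2 v) (fac s3 (c1 * u + c2 * v)) (fac s4 (d1 * u + d2 * v))
        (by rintro ⟨rfl, rfl⟩; exact hw rfl)
        (by rintro ⟨rfl, h⟩; simp [hc2] at h; exact hw (by simp [h]))
        (by rintro ⟨rfl, h⟩; simp [hd2] at h; exact hw (by simp [h]))
        (by rintro ⟨rfl, h⟩; simp [hc1] at h; exact hw (by simp [h]))
        (by rintro ⟨rfl, h⟩; simp [hd1] at h; exact hw (by simp [h]))
        (by
          rintro ⟨ha, hb⟩
          have g1 : (c1 * d2 - c2 * d1) * u = 0 := by linear_combination d2 * ha - c2 * hb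
          have g2 : (c1 * d2 - c2 * d1) * v = 0 := by linear_combination c1 * hb - d1 * ha
          simp only [mul_eq_zero, hd, false_or] at g1 g2
          exact hw (by simp [g1, g2]))
      have hz : zr c1 c2 d1 d2 (u, v) = ind (u = 0) + ind (v = 0) + ind (c1 * u + c2 * v = 0) +
        ind (d1 * u + d2 * v = 0) := by simp [zr, ind]
      rw [hz]
      refine le_trans ?_ this
      exact ite_mono And.right
  rw [Finset.sum_sub_distrib, Finset.sum_add_distrib, ← Finset.mul_sum, Z] at key
  simp only [Finset.sum_ite_eq', mem_univ, if_true] at key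
  have key' : 16 * ((univ.filter fun w => E w ∧ pat c1 c2 d1 d2 s1 s2 s3 s4 w).card : ℝ) ≤
    ((∑ w : F × F, prd c1 c2 d1 d2 (eps s1) (eps s2) (eps s3) (eps s4) w : ℤ) : ℝ) +
      8 * (4 * Fintype.card F) - 33 := by exact_mod_cast key
  nlinarith

lemma T_lower (h2 : (2 : F) ≠ 0) (c1 c2 d1 d2 : F) (hc1 : c1 ≠ 0) (hc2 : c2 ≠ 0) (hd1 : d1 ≠ 0)
    (hd2 : d2 ≠ 0) (hd : c1 * d2 - c2 * d1 ≠ 0) (s1 s2 s3 s4 : Bool) (E : F × F → Prop)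
    (p1 p2 r1 r2 : F) (hp : p2 ≠ 0) (hr : r2 ≠ 0)
    (hE : ∀ w, p1 * w.1 + p2 * w.2 ≠ 0 → r1 * w.1 + r2 * w.2 ≠ 0 → E w) :
    (Fintype.card F : ℝ) ^ 2 - 64 * Fintype.card F -
      ((Fintype.card F : ℝ) - 1) * (2 * Real.sqrt (Fintype.card F) + 4) ≤
    16 * ((univ.filter fun w => E w ∧ pat c1 c2 d1 d2 s1 s2 s3 s4 w).card : ℝ) := by
  have P := (abs_le.1 (plane_sum h2 c1 c2 d1 d2 hc1 hc2 hd1 hd2 hd (eps s1) (eps s2) (eps s3) (eps s4)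
    (eps_or _) (eps_or _) (eps_or _) (eps_or _))).1
  have Z := zr_sum c1 c2 d1 d2 hc2 hd2
  have Z1 : ∑ w : F × F, ind (p1 * w.1 + p2 * w.2 = 0) = Fintype.card F := by
    simpa only [ind] using line_sum p1 p2 hp
  have Z2 : ∑ w : F × F, ind (r1 * w.1 + r2 * w.2 = 0) = Fintype.card F := by
    simpa only [ind] using line_sum r1 r2 hr
  have key : ∑ w : F × F, prd c1 c2 d1 d2 (eps s1) (eps s2) (eps s3) (eps s4) w ≤
      16 * ((univ.filter fun w => E w ∧ pat c1 c2 d1 d2 s1 s2 s3 s4 w).card : ℤ) +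
      8 * ∑ w : F × F, zr c1 c2 d1 d2 w +
      16 * ∑ w : F × F, ind (p1 * w.1 + p2 * w.2 = 0) +
      16 * ∑ w : F × F, ind (r1 * w.1 + r2 * w.2 = 0) := by
    rw [card_ind]
    rw [Finset.mul_sum, Finset.mul_sum, Finset.mul_sum, Finset.mul_sum, ← Finset.sum_add_distrib,
      ← Finset.sum_add_distrib, ← Finset.sum_add_distrib]
    apply Finset.sum_le_sum
    rintro ⟨u, v⟩ _
    have := low_aux (fac s1 u) (fac s2 v) (fac s3 (c1 * u + c2 * v)) (fac s4 (d1 * u + d2 * v))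
    refine le_trans this ?_
    have hE' := hE (u, v)
    have e : 16 * ind (pat c1 c2 d1 d2 s1 s2 s3 s4 (u, v)) ≤
      16 * ind (E (u, v) ∧ pat c1 c2 d1 d2 s1 s2 s3 s4 (u, v)) +
      16 * ind (p1 * u + p2 * v = 0) + 16 * ind (r1 * u + r2 * v = 0) := ite_mono3 hE'
    have hz : zr c1 c2 d1 d2 (u, v) = ind (u = 0) + ind (v = 0) + ind (c1 * u + c2 * v = 0) +
        ind (d1 * u + d2 * v = 0) := by simp [zr, ind]
    rw [hz]
    have e2 : ind (pat c1 c2 d1 d2 s1 s2 s3 s4 (u, v)) = ind ((inR u ↔ s1 = true) ∧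
      (inR v ↔ s2 = true) ∧ (inR (c1 * u + c2 * v) ↔ s3 = true) ∧
      (inR (d1 * u + d2 * v) ↔ s4 = true)) := rfl
    rw [e2] at e
    dsimp only
    linarith
  rw [Z, Z1, Z2] at key
  have key' : ((∑ w : F × F, prd c1 c2 d1 d2 (eps s1) (eps s2) (eps s3) (eps s4) w : ℤ) : ℝ) ≤
    16 * ((univ.filter fun w => E w ∧ pat c1 c2 d1 d2 s1 s2 s3 s4 w).card : ℝ) +
      8 * (4 * Fintype.card F) + 16 * Fintype.card F + 16 * Fintype.card F := by exact_mod_cast key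
  linarith

end Pattern

section Cells

lemma squares_card (h2 : (2 : F) ≠ 0) :
    2 * ((univ.filter fun x : F => inR x).card : ℤ) + 1 = Fintype.card F := by
  have h : ∀ x : F, 2 * ind (inR x) + (if x = 0 then 1 else 0) = 1 + ch x := by
    intro x
    by_cases hx : x = 0
    · simp [hx, ind, inR, ch]
    · by_cases hs : IsSquare x
      · have : ch x = 1 := (quadraticChar_one_iff_isSquare hx).2 hs
        simp [this, ind, inR, hx, hs]
      · have : ch x = -1 := quadraticChar_neg_one_iff_not_isSquare.2 hs
        simp [this, ind, inR, hx, hs]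
  have hsum : ∑ x : F, (2 * ind (inR x) + (if x = 0 then 1 else 0)) = ∑ x : F, (1 + ch x) :=
    Finset.sum_congr rfl fun x _ => h x
  rw [Finset.sum_add_distrib, Finset.sum_add_distrib, ← Finset.mul_sum, ← card_ind,
    quadraticChar_sum_zero (char_ne h2)] at hsum
  simpa using hsum

lemma ray_bound (h2 : (2 : F) ≠ 0) (A : Finset (F × F × F)) (n1 n2 n3 α β γ : F)
    (hn : ¬ (n1 = 0 ∧ n2 = 0 ∧ n3 = 0))
    (hA : ∀ t ∈ A, t.2.1 * n2 = t.2.2 * n1 ∧ t.2.1 * n3 = t.1 * n1 ∧ t.2.2 * n3 = t.1 * n2)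
    (hL : ∀ t ∈ A, inR (α * t.2.1 + β * t.2.2 + γ * t.1)) :
    2 * (A.card : ℤ) + 1 ≤ Fintype.card F := by
  rw [← squares_card h2]
  have : A.card ≤ (univ.filter fun x : F => inR x).card := by
    apply Finset.card_le_card_of_injOn (fun t => α * t.2.1 + β * t.2.2 + γ * t.1)
    · intro t ht
      simpa using hL t ht
    · rintro ⟨e, u, v⟩ ht ⟨e', u', v'⟩ ht' heq
      obtain ⟨a1, a2, a3⟩ := hA _ ht
      obtain ⟨b1, b2, b3⟩ := hA _ ht'
      have h0 := (hL _ ht).1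
      simp only at *
      set M := α * n1 + β * n2 + γ * n3 with hM
      set x := α * u + β * v + γ * e with hx
      have m0 : M ≠ 0 := by
        intro h
        apply hn
        have g1 : x * n1 = 0 := by linear_combination u * h - β * a1 - γ * a2
        have g2 : x * n2 = 0 := by linear_combination v * h + α * a1 - γ * a3
        have g3 : x * n3 = 0 := by linear_combination e * h + α * a2 + β * a3
        simp only [mul_eq_zero, h0, false_or] at g1 g2 g3
        exact ⟨g1, g2, g3⟩
      have f1 : M * (u - u') = 0 := by
        linear_combination β * a1 + γ * a2 - β * b1 - γ * b2 + n1 * heq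
      have f2 : M * (v - v') = 0 := by
        linear_combination -α * a1 + γ * a3 + α * b1 - γ * b3 + n2 * heq
      have f3 : M * (e - e') = 0 := by
        linear_combination -α * a2 - β * a3 + α * b2 + β * b3 + n3 * heq
      simp only [mul_eq_zero, m0, false_or, sub_eq_zero] at f1 f2 f3
      rw [f1, f2, f3]
  omega

/-- Solutions with prescribed residue pattern, as triples `(e, u, v)`. -/
def Cell (k11 k12 k21 k22 : F) (s1 s2 s3 s4 : Bool) (t : F × F × F) : Prop :=
  t.1 ≠ 0 ∧ t.2.1 ≠ t.2.2 ∧ k11 * t.2.1 = t.1 + k22 * (t.2.2 - t.1) ∧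
  k12 * t.2.2 = t.1 + k21 * (t.2.1 - t.1) ∧
  (inR t.2.1 ↔ s1 = true) ∧ (inR t.2.2 ↔ s2 = true) ∧ (inR (t.2.1 - t.1) ↔ s3 = true) ∧
  (inR (t.2.2 - t.1) ↔ s4 = true)

/-- Number of solutions with prescribed pattern. -/
def cc (k11 k12 k21 k22 : F) (s1 s2 s3 s4 : Bool) : ℕ :=
  (univ.filter fun t => Cell k11 k12 k21 k22 s1 s2 s3 s4 t).card

lemma cc_const (h2 : (2 : F) ≠ 0) (k : F) (hk : k ≠ 1) (s1 s2 s3 s4 : Bool) :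
    cc k k k k s1 s2 s3 s4 = 0 := by
  unfold cc
  rw [Finset.card_eq_zero, Finset.filter_eq_empty_iff]
  rintro ⟨e, u, v⟩ _ ⟨he, _, h3, h4, _⟩
  simp only at *
  have : 2 * (e * (1 - k)) = 0 := by linear_combination -h3 - h4
  simp only [mul_eq_zero, h2, he, false_or, sub_eq_zero] at this
  exact hk this.symm

lemma cc_ray (h2 : (2 : F) ≠ 0) (k11 k12 k21 k22 : F) (s1 s2 s3 s4 : Bool)
    (hs : s1 = true ∨ s2 = true ∨ s3 = true ∨ s4 = true)
    (hn : ¬ (k22 * (1 - k21) + (1 - k22) * k12 = 0 ∧ (1 - k22) * k21 + k11 * (1 - k21) = 0 ∧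
      k11 * k12 - k22 * k21 = 0)) :
    2 * (cc k11 k12 k21 k22 s1 s2 s3 s4 : ℤ) + 1 ≤ Fintype.card F := by
  unfold cc
  have hA : ∀ t ∈ univ.filter fun t => Cell k11 k12 k21 k22 s1 s2 s3 s4 t,
    t.2.1 * ((1 - k22) * k21 + k11 * (1 - k21)) = t.2.2 * (k22 * (1 - k21) + (1 - k22) * k12) ∧
    t.2.1 * (k11 * k12 - k22 * k21) = t.1 * (k22 * (1 - k21) + (1 - k22) * k12) ∧
    t.2.2 * (k11 * k12 - k22 * k21) = t.1 * ((1 - k22) * k21 + k11 * (1 - k21)) := by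
    rintro ⟨e, u, v⟩ ht
    rw [mem_filter] at ht
    obtain ⟨_, _, _, h3, h4, _⟩ := ht
    simp only at *
    refine ⟨?_, ?_, ?_⟩
    · linear_combination (1 - k21) * h3 - (1 - k22) * h4
    · linear_combination k12 * h3 + k22 * h4
    · linear_combination k21 * h3 + k11 * h4
  have hp : ∀ t ∈ univ.filter fun t => Cell k11 k12 k21 k22 s1 s2 s3 s4 t,
    (inR t.2.1 ↔ s1 = true) ∧ (inR t.2.2 ↔ s2 = true) ∧ (inR (t.2.1 - t.1) ↔ s3 = true) ∧
      (inR (t.2.2 - t.1) ↔ s4 = true) := by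
    rintro ⟨e, u, v⟩ ht
    rw [mem_filter] at ht
    obtain ⟨_, _, _, _, _, h⟩ := ht
    exact h
  rcases hs with h | h | h | h
  · exact ray_bound h2 _ _ _ _ 1 0 0 hn hA fun t ht => by
      simpa using (hp t ht).1.2 h
  · exact ray_bound h2 _ _ _ _ 0 1 0 hn hA fun t ht => by
      simpa using (hp t ht).2.1.2 h
  · exact ray_bound h2 _ _ _ _ 1 0 (-1) hn hA fun t ht => by
      simpa [sub_eq_add_neg] using (hp t ht).2.2.1.2 h
  · exact ray_bound h2 _ _ _ _ 0 1 (-1) hn hA fun t ht => by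
      simpa [sub_eq_add_neg] using (hp t ht).2.2.2.2 h

lemma cc_special (h2 : (2 : F) ≠ 0) (k k12 k21 l c : F) (s1 s2 s3 s4 : Bool)
    (hk : k ≠ 0) (hk1 : k ≠ 1) (hl : l ≠ 0) (hl1 : l ≠ 1) (hkl : k + l ≠ 1)
    (e1 : k12 = -c * l) (e2 : k21 = -c * k) (e3 : 1 - k21 = c * (1 - l)) :
    16 * (cc k k12 k21 l s1 s2 s3 s4 : ℝ) ≤
      ((Fintype.card F : ℝ) - 1) * (Fintype.card F + 33 + (2 * Real.sqrt (Fintype.card F) + 4)) ∧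
    (Fintype.card F : ℝ) ^ 2 - 64 * Fintype.card F -
      ((Fintype.card F : ℝ) - 1) * (2 * Real.sqrt (Fintype.card F) + 4) ≤
    16 * (cc k k12 k21 l s1 s2 s3 s4 : ℝ) := by
  have l1 : 1 - l ≠ 0 := sub_ne_zero.2 hl1.symm
  have k1 : 1 - k ≠ 0 := sub_ne_zero.2 hk1.symm
  have kl : 1 - l - k ≠ 0 := by
    intro h; apply hkl; linear_combination -h
  have hcard : cc k k12 k21 l s1 s2 s3 s4 = (univ.filter fun w : F × F =>
      (w.1 ≠ w.2 ∧ k * w.1 - l * w.2 ≠ 0) ∧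
      pat ((1 - l - k) / (1 - l)) (l / (1 - l)) (-k / (1 - l)) (1 / (1 - l)) s1 s2 s3 s4 w).card := by
    unfold cc
    have f1 : ∀ u v : F, (1 - l - k) / (1 - l) * u + l / (1 - l) * v = u - (k * u - l * v) / (1 - l) := by
      intro u v; field_simp; ring
    have f2 : ∀ u v : F, -k / (1 - l) * u + 1 / (1 - l) * v = v - (k * u - l * v) / (1 - l) := by
      intro u v; field_simp; ring
    apply Finset.card_nbij' (fun t => (t.2.1, t.2.2))
      (fun w => ((k * w.1 - l * w.2) / (1 - l), w.1, w.2))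
    · rintro ⟨e, u, v⟩ ht
      simp only [mem_coe, mem_filter, mem_univ, true_and] at ht ⊢
      simp only [Cell, pat, f1, f2] at ht ⊢
      obtain ⟨a1, a2, a3, a4, a5, a6, a7, a8⟩ := ht
      have he : k * u - l * v = e * (1 - l) := by linear_combination a3
      rw [he, mul_div_cancel_right₀ _ l1]
      exact ⟨⟨a2, mul_ne_zero a1 l1⟩, a5, a6, a7, a8⟩
    · rintro ⟨u, v⟩ ht
      simp only [mem_coe, mem_filter, mem_univ, true_and] at ht ⊢
      simp only [Cell, pat, f1, f2] at ht ⊢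
      obtain ⟨⟨a1, a2⟩, a5, a6, a7, a8⟩ := ht
      refine ⟨div_ne_zero a2 l1, a1, ?_, ?_, a5, a6, a7, a8⟩
      · field_simp; ring
      · have he : (k * u - l * v) / (1 - l) * (1 - l) = k * u - l * v := div_mul_cancel₀ _ l1
        rw [e1]
        set e := (k * u - l * v) / (1 - l)
        have e3' : 1 + c * k = c * (1 - l) := by rw [← e3, e2]; ring
        rw [e2]
        linear_combination -c * he - e * e3'
    · rintro ⟨e, u, v⟩ ht
      simp only [mem_coe, mem_filter, mem_univ, true_and] at ht ⊢
      simp only [Cell] at ht ⊢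
      obtain ⟨a1, a2, a3, _⟩ := ht
      have he : k * u - l * v = e * (1 - l) := by linear_combination a3
      rw [he, mul_div_cancel_right₀ _ l1]
    · rintro ⟨u, v⟩ _
      rfl
  have hd : (1 - l - k) / (1 - l) * (1 / (1 - l)) - l / (1 - l) * (-k / (1 - l)) ≠ 0 := by
    have : (1 - l - k) / (1 - l) * (1 / (1 - l)) - l / (1 - l) * (-k / (1 - l)) =
      (1 - k) / (1 - l) := by field_simp; ring
    rw [this]
    exact div_ne_zero k1 l1
  rw [hcard]
  constructor
  · convert T_upper h2 _ _ _ _ (div_ne_zero kl l1) (div_ne_zero hl l1)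
      (div_ne_zero (neg_ne_zero.2 hk) l1) (div_ne_zero one_ne_zero l1) hd s1 s2 s3 s4
      (fun w : F × F => w.1 ≠ w.2 ∧ k * w.1 - l * w.2 ≠ 0) (by simp)
  · convert T_lower h2 _ _ _ _ (div_ne_zero kl l1) (div_ne_zero hl l1)
      (div_ne_zero (neg_ne_zero.2 hk) l1) (div_ne_zero one_ne_zero l1) hd s1 s2 s3 s4
      (fun w : F × F => w.1 ≠ w.2 ∧ k * w.1 - l * w.2 ≠ 0) 1 (-1) k (-l) (by simp) (by simpa)
      (by
        rintro ⟨u, v⟩ h h'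
        simp only at *
        constructor
        · rintro rfl
          apply h; ring
        · intro h0
          apply h'; linear_combination h0)

/-- Coefficient attached to a boolean. -/
def kap (a b : F) (s : Bool) : F := if s then a else b

/-- Number of solutions with pattern `s` for the pair `(a, b)`. -/
def mm (a b : F) (s : Bool × Bool × Bool × Bool) : ℕ :=
  cc (kap a b s.1) (kap a b s.2.1) (kap a b s.2.2.1) (kap a b s.2.2.2) s.1 s.2.1 s.2.2.1 s.2.2.2

lemma qmul_kap (a b x d : F) : qmul a b x (x + d) = x + kap a b (decide (inR d)) * d := by
  unfold qmul kap
  by_cases h : inR d <;> simp [h]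

lemma qmul_kap' (a b x e d : F) : qmul a b (x + e) (x + d) =
    x + e + kap a b (decide (inR (d - e))) * (d - e) := by
  rw [← qmul_kap]
  congr 1
  ring

lemma total_count (a b : F) :
    (univ.filter fun t : F × F × F × F =>
        t.1 ≠ t.2.1 ∧ t.2.2.1 ≠ t.2.2.2 ∧
        qmul a b t.1 t.2.2.1 = qmul a b t.2.1 t.2.2.2 ∧
        qmul a b t.1 t.2.2.2 = qmul a b t.2.1 t.2.2.1).card =
      Fintype.card F * ∑ s : Bool × Bool × Bool × Bool, mm a b s := by
  have hbij : Function.Bijective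
      (fun t : F × F × F × F => (t.1, t.1 + t.2.1, t.1 + t.2.2.1, t.1 + t.2.2.2)) := by
    apply Finite.injective_iff_bijective.1
    rintro ⟨x, y, z, w⟩ ⟨x', y', z', w'⟩ h
    simp only [Prod.mk.injEq] at h
    obtain ⟨rfl, h1, h2, h3⟩ := h
    simp only [add_right_inj] at h1 h2 h3
    rw [h1, h2, h3]
  zify
  rw [card_ind, ← hbij.sum_comp, Fintype.sum_prod_type]
  have inner : ∀ (r : F) (t : F × F × F), ind (r ≠ r + t.1 ∧ r + t.2.1 ≠ r + t.2.2 ∧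
      qmul a b r (r + t.2.1) = qmul a b (r + t.1) (r + t.2.2) ∧
      qmul a b r (r + t.2.2) = qmul a b (r + t.1) (r + t.2.1)) =
      ∑ s : Bool × Bool × Bool × Bool, ind (Cell (kap a b s.1) (kap a b s.2.1) (kap a b s.2.2.1)
        (kap a b s.2.2.2) s.1 s.2.1 s.2.2.1 s.2.2.2 t) := by
    rintro r ⟨e, u, v⟩
    simp only [qmul_kap, qmul_kap']
    rw [Finset.sum_eq_single (decide (inR u), decide (inR v), decide (inR (u - e)),
      decide (inR (v - e)))]
    · congr 1
      simp only [Cell, decide_eq_true_eq, and_true, eq_iff_iff]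
      constructor
      · rintro ⟨h1, h2, h3, h4⟩
        refine ⟨?_, ?_, ?_, ?_⟩
        · rintro rfl; simp at h1
        · rintro rfl; simp at h2
        · linear_combination h3
        · linear_combination h4
      · rintro ⟨h1, h2, h3, h4⟩
        refine ⟨?_, ?_, ?_, ?_⟩
        · simpa using h1
        · simpa using h2
        · linear_combination h3
        · linear_combination h4
    · rintro ⟨s1, s2, s3, s4⟩ _ hne
      apply ind_neg
      rintro ⟨_, _, _, _, h1, h2, h3, h4⟩
      apply hne
      simp only at h1 h2 h3 h4
      simp only [h1, h2, h3, h4, Bool.decide_eq_true]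
    · simp
  simp only [inner]
  rw [Finset.sum_const, card_univ, nsmul_eq_mul, Finset.sum_comm]
  congr 1
  apply Finset.sum_congr rfl
  intro s _
  unfold mm cc
  rw [card_ind]

end Cells

section Final

/-- The bounds satisfied by the two special patterns. -/
def Spec (F : Type*) [Fintype F] (x : ℕ) : Prop :=
  16 * (x : ℝ) ≤
      ((Fintype.card F : ℝ) - 1) * (Fintype.card F + 33 + (2 * Real.sqrt (Fintype.card F) + 4)) ∧
    (Fintype.card F : ℝ) ^ 2 - 64 * Fintype.card F -
      ((Fintype.card F : ℝ) - 1) * (2 * Real.sqrt (Fintype.card F) + 4) ≤ 16 * (x : ℝ)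

lemma mm_mk (a b : F) (s1 s2 s3 s4 : Bool) : mm a b (s1, s2, s3, s4) =
    cc (kap a b s1) (kap a b s2) (kap a b s3) (kap a b s4) s1 s2 s3 s4 := rfl

lemma kap_true (a b : F) : kap a b true = a := by simp [kap]

lemma kap_false (a b : F) : kap a b false = b := by simp [kap]

lemma rays (h2 : (2 : F) ≠ 0) (a b : F) (a0 : a ≠ 0) (b0 : b ≠ 0)
    (hab : a ≠ b) :
    2 * (mm a b (true, true, true, false) : ℤ) + 1 ≤ Fintype.card F ∧
    2 * (mm a b (true, true, false, true) : ℤ) + 1 ≤ Fintype.card F ∧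
    2 * (mm a b (true, false, true, true) : ℤ) + 1 ≤ Fintype.card F ∧
    2 * (mm a b (false, true, true, true) : ℤ) + 1 ≤ Fintype.card F ∧
    2 * (mm a b (false, false, false, true) : ℤ) + 1 ≤ Fintype.card F ∧
    2 * (mm a b (false, false, true, false) : ℤ) + 1 ≤ Fintype.card F ∧
    2 * (mm a b (false, true, false, false) : ℤ) + 1 ≤ Fintype.card F ∧
    2 * (mm a b (true, false, false, false) : ℤ) + 1 ≤ Fintype.card F := by
  have ab : a - b ≠ 0 := sub_ne_zero.2 hab
  have p1 : a * (a - b) ≠ 0 := mul_ne_zero a0 ab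
  have p2 : b * (a - b) ≠ 0 := mul_ne_zero b0 ab
  simp only [mm_mk, kap_true, kap_false]
  refine ⟨?_, ?_, ?_, ?_, ?_, ?_, ?_, ?_⟩
  · refine cc_ray h2 _ _ _ _ _ _ _ _ (by simp) ?_
    rintro ⟨_, _, h⟩
    exact p1 (by linear_combination h)
  · refine cc_ray h2 _ _ _ _ _ _ _ _ (by simp) ?_
    rintro ⟨_, _, h⟩
    exact p1 (by linear_combination h)
  · refine cc_ray h2 _ _ _ _ _ _ _ _ (by simp) ?_
    rintro ⟨_, _, h⟩
    exact p1 (by linear_combination -h)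
  · refine cc_ray h2 _ _ _ _ _ _ _ _ (by simp) ?_
    rintro ⟨_, _, h⟩
    exact p1 (by linear_combination -h)
  · refine cc_ray h2 _ _ _ _ _ _ _ _ (by simp) ?_
    rintro ⟨_, _, h⟩
    exact p2 (by linear_combination -h)
  · refine cc_ray h2 _ _ _ _ _ _ _ _ (by simp) ?_
    rintro ⟨_, _, h⟩
    exact p2 (by linear_combination -h)
  · refine cc_ray h2 _ _ _ _ _ _ _ _ (by simp) ?_
    rintro ⟨_, _, h⟩
    exact p2 (by linear_combination h)
  · refine cc_ray h2 _ _ _ _ _ _ _ _ (by simp) ?_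
    rintro ⟨_, _, h⟩
    exact p2 (by linear_combination h)

lemma ray_s1 (h2 : (2 : F) ≠ 0) (a b : F) (hab : a ≠ b) (hh : a + b ≠ 0) :
    2 * (mm a b (true, true, false, false) : ℤ) + 1 ≤ Fintype.card F ∧
    2 * (mm a b (false, false, true, true) : ℤ) + 1 ≤ Fintype.card F := by
  have p3 := mul_ne_zero (sub_ne_zero.2 hab) hh
  simp only [mm_mk, kap_true, kap_false]
  constructor
  · refine cc_ray h2 _ _ _ _ _ _ _ _ (by simp) ?_
    rintro ⟨_, _, h⟩
    exact p3 (by linear_combination h)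
  · refine cc_ray h2 _ _ _ _ _ _ _ _ (by simp) ?_
    rintro ⟨_, _, h⟩
    exact p3 (by linear_combination -h)

lemma ray_s2 (h2 : (2 : F) ≠ 0) (a b : F) (a0 : a ≠ 0) (b0 : b ≠ 0) (hh : a + b ≠ 2) :
    2 * (mm a b (true, false, true, false) : ℤ) + 1 ≤ Fintype.card F ∧
    2 * (mm a b (false, true, false, true) : ℤ) + 1 ≤ Fintype.card F := by
  have hh' : 2 - (a + b) ≠ 0 := sub_ne_zero.2 hh.symm
  simp only [mm_mk, kap_true, kap_false]
  constructor
  · refine cc_ray h2 _ _ _ _ _ _ _ _ (by simp) ?_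
    rintro ⟨h, _, _⟩
    exact mul_ne_zero b0 hh' (by linear_combination h)
  · refine cc_ray h2 _ _ _ _ _ _ _ _ (by simp) ?_
    rintro ⟨h, _, _⟩
    exact mul_ne_zero a0 hh' (by linear_combination h)

lemma ray_s3 (h2 : (2 : F) ≠ 0) (a b : F) (hh : a + b ≠ 2 * a * b) :
    2 * (mm a b (true, false, false, true) : ℤ) + 1 ≤ Fintype.card F ∧
    2 * (mm a b (false, true, true, false) : ℤ) + 1 ≤ Fintype.card F := by
  simp only [mm_mk, kap_true, kap_false]
  constructor
  · refine cc_ray h2 _ _ _ _ _ _ _ _ (by simp) ?_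
    rintro ⟨h, _, _⟩
    exact hh (by linear_combination h)
  · refine cc_ray h2 _ _ _ _ _ _ _ _ (by simp) ?_
    rintro ⟨h, _, _⟩
    exact hh (by linear_combination h)

lemma spec_1 (h2 : (2 : F) ≠ 0) (a b : F) (a0 : a ≠ 0) (b0 : b ≠ 0) (a1 : a ≠ 1) (b1 : b ≠ 1)
    (hb : a + b = 0) :
    Spec F (mm a b (true, true, false, false)) ∧
    Spec F (mm a b (false, false, true, true)) := by
  unfold Spec
  simp only [mm_mk, kap_true, kap_false]
  constructor
  · exact cc_special h2 a a b b 1 _ _ _ _ a0 a1 b0 b1 (by rw [hb]; exact zero_ne_one)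
      (by linear_combination hb) (by linear_combination hb) (by ring)
  · exact cc_special h2 b b a a 1 _ _ _ _ b0 b1 a0 a1 (by rw [add_comm, hb]; exact zero_ne_one)
      (by linear_combination hb) (by linear_combination hb) (by ring)

lemma spec_2 (h2 : (2 : F) ≠ 0) (a b : F) (a0 : a ≠ 0) (b0 : b ≠ 0) (a1 : a ≠ 1) (b1 : b ≠ 1)
    (hb : a + b = 2) :
    Spec F (mm a b (true, false, true, false)) ∧
    Spec F (mm a b (false, true, false, true)) := by
  have h21 : (2 : F) ≠ 1 := by
    intro h; exact one_ne_zero (α := F) (by linear_combination h)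
  unfold Spec
  simp only [mm_mk, kap_true, kap_false]
  constructor
  · exact cc_special h2 a b a b (-1) _ _ _ _ a0 a1 b0 b1 (by rw [hb]; exact h21)
      (by ring) (by ring) (by linear_combination -hb)
  · exact cc_special h2 b a b a (-1) _ _ _ _ b0 b1 a0 a1 (by rw [add_comm, hb]; exact h21)
      (by ring) (by ring) (by linear_combination -hb)

lemma spec_3 (h2 : (2 : F) ≠ 0) (a b : F) (a0 : a ≠ 0) (b0 : b ≠ 0) (a1 : a ≠ 1) (b1 : b ≠ 1)
    (hb : a + b = 2 * a * b) :
    Spec F (mm a b (true, false, false, true)) ∧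
    Spec F (mm a b (false, true, true, false)) := by
  have ha2 : a + a ≠ 1 := by
    intro h; exact a0 (by linear_combination hb + b * h)
  have hb2 : b + b ≠ 1 := by
    intro h; exact b0 (by linear_combination hb + a * h)
  unfold Spec
  simp only [mm_mk, kap_true, kap_false]
  constructor
  · refine cc_special h2 a b b a (-(b / a)) _ _ _ _ a0 a1 a0 a1 ha2 ?_ ?_ ?_
    · field_simp
    · field_simp
    · field_simp
      linear_combination hb
  · refine cc_special h2 b a a b (-(a / b)) _ _ _ _ b0 b1 b0 b1 hb2 ?_ ?_ ?_
    · field_simp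
    · field_simp
    · field_simp
      linear_combination hb

lemma main_cells (h2 : (2 : F) ≠ 0) (a b : F) (a0 : a ≠ 0) (b0 : b ≠ 0) (a1 : a ≠ 1) (b1 : b ≠ 1)
    (hab : a ≠ b) (hb : a + b = 0 ∨ a + b = 2 ∨ a + b = 2 * a * b) :
    ∃ x y : ℕ, Spec F x ∧ Spec F y ∧
      ((x + y : ℕ) : ℤ) ≤ ((∑ s : Bool × Bool × Bool × Bool, mm a b s : ℕ) : ℤ) ∧
      ((∑ s : Bool × Bool × Bool × Bool, mm a b s : ℕ) : ℤ) ≤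
        x + y + 6 * ((Fintype.card F : ℤ) - 1) := by
  have c1 : mm a b (true, true, true, true) = 0 := by
    simp only [mm_mk, kap_true, kap_false]; exact cc_const h2 a a1 _ _ _ _
  have c2 : mm a b (false, false, false, false) = 0 := by
    simp only [mm_mk, kap_true, kap_false]; exact cc_const h2 b b1 _ _ _ _
  obtain ⟨o1, o2, o3, o4, o5, o6, o7, o8⟩ := rays h2 a b a0 b0 hab
  have s1 := ray_s1 h2 a b hab
  have s2 := ray_s2 h2 a b a0 b0
  have s3 := ray_s3 h2 a b
  have t1 := spec_1 h2 a b a0 b0 a1 b1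
  have t2 := spec_2 h2 a b a0 b0 a1 b1
  have t3 := spec_3 h2 a b a0 b0 a1 b1
  simp only [Fintype.sum_prod_type, Fintype.sum_bool]
  generalize mm a b (true, true, true, true) = m0 at *
  generalize mm a b (true, true, true, false) = m1 at *
  generalize mm a b (true, true, false, true) = m2 at *
  generalize mm a b (true, true, false, false) = m3 at *
  generalize mm a b (true, false, true, true) = m4 at *
  generalize mm a b (true, false, true, false) = m5 at *
  generalize mm a b (true, false, false, true) = m6 at *
  generalize mm a b (true, false, false, false) = m7 at *
  generalize mm a b (false, true, true, true) = m8 at *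
  generalize mm a b (false, true, true, false) = m9 at *
  generalize mm a b (false, true, false, true) = m10 at *
  generalize mm a b (false, true, false, false) = m11 at *
  generalize mm a b (false, false, true, true) = m12 at *
  generalize mm a b (false, false, true, false) = m13 at *
  generalize mm a b (false, false, false, true) = m14 at *
  generalize mm a b (false, false, false, false) = m15 at *
  generalize hq : (Fintype.card F : ℤ) = q at *
  rcases hb with hb | hb | hb
  · obtain ⟨u1, u2⟩ := t1 hb
    obtain ⟨v1, v2⟩ := s2 (by rw [hb]; exact h2.symm)
    obtain ⟨w1, w2⟩ := s3 (by rw [hb]; exact (mul_ne_zero (mul_ne_zero h2 a0) b0).symm)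
    refine ⟨_, _, u1, u2, ?_, ?_⟩
    · clear s1 s2 s3 t1 t2 t3 u1 u2
      push_cast; linarith
    · clear s1 s2 s3 t1 t2 t3 u1 u2
      push_cast; linarith
  · obtain ⟨u1, u2⟩ := t2 hb
    obtain ⟨v1, v2⟩ := s1 (by rw [hb]; exact h2)
    obtain ⟨w1, w2⟩ := s3 (by
      intro h
      have : 2 * ((a - 1) * (a - 1)) = 0 := by
        have hb' : b = 2 - a := by linear_combination hb
        rw [hb'] at h; linear_combination h
      simp only [mul_eq_zero, h2, false_or, or_self, sub_eq_zero] at this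
      exact a1 this)
    refine ⟨_, _, u1, u2, ?_, ?_⟩
    · clear s1 s2 s3 t1 t2 t3 u1 u2
      push_cast; linarith
    · clear s1 s2 s3 t1 t2 t3 u1 u2
      push_cast; linarith
  · obtain ⟨u1, u2⟩ := t3 hb
    obtain ⟨v1, v2⟩ := s1 (by rw [hb]; exact mul_ne_zero (mul_ne_zero h2 a0) b0)
    obtain ⟨w1, w2⟩ := s2 (by
      intro h
      have : 2 * ((a - 1) * (a - 1)) = 0 := by
        have hb' : b = 2 - a := by linear_combination h
        rw [hb'] at hb; linear_combination hb
      simp only [mul_eq_zero, h2, false_or, or_self, sub_eq_zero] at this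
      exact a1 this)
    refine ⟨_, _, u1, u2, ?_, ?_⟩
    · clear s1 s2 s3 t1 t2 t3 u1 u2
      push_cast; linarith
    · clear s1 s2 s3 t1 t2 t3 u1 u2
      push_cast; linarith

lemma num_final (r M x y N q : ℝ) (hr0 : 0 ≤ r) (hr : r ^ 2 = q) (hq3 : 3 ≤ q)
    (hN0 : 0 ≤ N) (hN : 4 * N = q * M) (l1 : x + y ≤ M) (l2 : M ≤ x + y + 6 * (q - 1))
    (x1 : 16 * x ≤ (q - 1) * (q + 33 + (2 * r + 4)))
    (x2 : q ^ 2 - 64 * q - (q - 1) * (2 * r + 4) ≤ 16 * x)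
    (y1 : 16 * y ≤ (q - 1) * (q + 33 + (2 * r + 4)))
    (y2 : q ^ 2 - 64 * q - (q - 1) * (2 * r + 4) ≤ 16 * y) :
    q * (q - 1) * (q - 11 * r - 38) / 32 ≤ N ∧ N ≤ q * (q - 1) * (q + 11 * r + 70) / 32 := by
  subst hr
  have hr1 : 5 / 3 ≤ r := by
    by_contra h
    push Not at h
    have := mul_le_mul h.le h.le hr0 (by norm_num)
    linarith
  have hNM : N = r ^ 2 * M / 4 := by linarith
  have hr2 : 0 ≤ r ^ 2 := by positivity
  constructor
  · by_cases h : r ^ 2 - 11 * r - 38 ≤ 0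
    · refine le_trans ?_ hN0
      have : r ^ 2 * (r ^ 2 - 1) * (r ^ 2 - 11 * r - 38) ≤ 0 :=
        mul_nonpos_of_nonneg_of_nonpos (mul_nonneg hr2 (by linarith)) h
      linarith
    · have hr5 : 13 ≤ r := by
        by_contra h'
        push Not at h'
        have := mul_nonneg hr0 (sub_nonneg.2 h'.le)
        linarith
      have h3 := mul_nonneg (sub_nonneg.2 hr5) hr2
      have h4 := mul_nonneg (sub_nonneg.2 hr5) hr0
      have key : (r ^ 2 - 1) * (r ^ 2 - 11 * r - 38) ≤ 8 * M := by
        linarith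
      have := mul_le_mul_of_nonneg_left key hr2
      rw [hNM]
      linarith
  · have key : 8 * M ≤ (r ^ 2 - 1) * (r ^ 2 + 11 * r + 70) := by
      have := mul_nonneg (show 0 ≤ r ^ 2 - 1 by linarith) (show 0 ≤ 9 * r - 15 by linarith)
      linarith
    have := mul_le_mul_of_nonneg_left key hr2
    rw [hNM]
    linarith

end Final

/-- For a valid pair `(a,b)` with `b ∈ {-a, 2-a, a/(2a-1)}`, the number `N` of intercalates
of `Q_{a,b}` satisfies `q(q-1)(q - 11√q - 38)/32 ≤ N ≤ q(q-1)(q + 11√q + 70)/32`. -/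
theorem intercalate_count_special
    (hodd : Odd (Fintype.card F)) (a b : F) (hv : ValidPair a b)
    (hb : b = -a ∨ b = 2 - a ∨ b = a / (2 * a - 1))
    (N : ℕ)
    (hN : 4 * N = (Finset.univ.filter fun t : F × F × F × F =>
        t.1 ≠ t.2.1 ∧ t.2.2.1 ≠ t.2.2.2 ∧
        qmul a b t.1 t.2.2.1 = qmul a b t.2.1 t.2.2.2 ∧
        qmul a b t.1 t.2.2.2 = qmul a b t.2.1 t.2.2.1).card) :
    (Fintype.card F : ℝ) * (Fintype.card F - 1) *
        ((Fintype.card F : ℝ) - 11 * Real.sqrt (Fintype.card F) - 38) / 32 ≤ (N : ℝ) ∧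
      (N : ℝ) ≤ (Fintype.card F : ℝ) * (Fintype.card F - 1) *
        ((Fintype.card F : ℝ) + 11 * Real.sqrt (Fintype.card F) + 70) / 32 := by
  have h2 : (2 : F) ≠ 0 := by
    intro h
    have hc : ringChar F = 2 := by
      have h1 : ringChar F ∣ 2 := (ringChar.spec F 2).1 (by exact_mod_cast h)
      rcases (Nat.dvd_prime Nat.prime_two).1 h1 with h3 | h3
      · have : ((1 : ℕ) : F) = 0 := (ringChar.spec F 1).2 (by rw [h3])
        simp at this
      · exact h3
    have := FiniteField.even_card_of_char_two hc
    rw [Nat.odd_iff] at hodd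
    omega
  obtain ⟨⟨hv1, _⟩, ⟨hv2, _⟩⟩ := hv
  have a0 : a ≠ 0 := left_ne_zero_of_mul hv1
  have b0 : b ≠ 0 := right_ne_zero_of_mul hv1
  have a1 : a ≠ 1 := sub_ne_zero.1 (left_ne_zero_of_mul hv2)
  have b1 : b ≠ 1 := sub_ne_zero.1 (right_ne_zero_of_mul hv2)
  have hb' : a + b = 0 ∨ a + b = 2 ∨ a + b = 2 * a * b := by
    rcases hb with h | h | h
    · left; rw [h]; ring
    · right; left; rw [h]; ring
    · right; right
      have h3 : 2 * a - 1 ≠ 0 := by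
        intro h0; rw [h0, div_zero] at h; exact b0 h
      rw [eq_div_iff h3] at h
      linear_combination -h
  have hab : a ≠ b := by
    rintro rfl
    rcases hb' with h | h | h
    · exact mul_ne_zero h2 a0 (by linear_combination h)
    · exact mul_ne_zero h2 (sub_ne_zero.2 a1) (by linear_combination h)
    · exact mul_ne_zero (mul_ne_zero h2 a0) (sub_ne_zero.2 a1) (by linear_combination -h)
  obtain ⟨x, y, ⟨x1, x2⟩, ⟨y1, y2⟩, l1, l2⟩ := main_cells h2 a b a0 b0 a1 b1 hab hb'
  rw [total_count] at hN
  set M := ∑ s : Bool × Bool × Bool × Bool, mm a b s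
  set q := Fintype.card F
  have hq3 : 3 ≤ q := by
    have : 1 < q := Fintype.one_lt_card
    rw [Nat.odd_iff] at hodd
    omega
  have hN' : 4 * (N : ℝ) = q * M := by exact_mod_cast hN
  have l1' : (x : ℝ) + y ≤ M := by exact_mod_cast l1
  have l2' : (M : ℝ) ≤ x + y + 6 * ((q : ℝ) - 1) := by exact_mod_cast l2
  have hq3' : (3 : ℝ) ≤ q := by exact_mod_cast hq3
  exact num_final _ M x y N q (Real.sqrt_nonneg _) (Real.sq_sqrt (by positivity)) hq3'
    (Nat.cast_nonneg N) hN' l1' l2' x1 x2 y1 y2
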